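/- Hopf bifurcation of a bicollared closed surface in a 3-manifold. Let M be a topological 3-manifold and let K ⊆ M be a compact set such that every point of K has an open neighborhood in K (subspace topology) homeomorphic to ℝ² (a closed 2-manifold) and such that K is bicollared in M. Let f : [0,1] × M → M be a continuous family of homeomorphisms of M such that K is an attractor of f₀ and a repeller of f_λ for every λ ∈ (0,1]. Then there exists λ₀ > 0 such that for every λ with 0 < λ < λ₀ there exists a compact attractor K_λ of f_λ which is a topological spine of a compact subset of M homeomorphic to (K × Fin 2) × [0,1] (so K_λ has the Borsuk homotopy type of two disjoint copies of K); moreover K_λ converges to K upper semicontinuously as λ → 0. -/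

import Mathlib

open Set Topology unitInterval

/-- `A` is homeomorphic to an open subset of `B`. -/
def HomeoToOpen (A : Type*) [TopologicalSpace A] (B : Type*) [TopologicalSpace B] : Prop :=
  ∃ U : Set B, IsOpen U ∧ Nonempty (A ≃ₜ U)

/-- The half-space `ℝ^{n-1} × [0,∞)`. -/
abbrev HalfSpace (n : ℕ) : Type :=
  EuclideanSpace ℝ (Fin (n - 1)) × {t : ℝ // 0 ≤ t}

/-- Every point has an open neighborhood homeomorphic to an open subset of `ℝⁿ`. -/
def LocallyEuclidean (n : ℕ) (M : Type*) [TopologicalSpace M] : Prop :=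
  ∀ x : M, ∃ V : Set M, IsOpen V ∧ x ∈ V ∧ HomeoToOpen V (EuclideanSpace ℝ (Fin n))

/-- Every point has an open neighborhood homeomorphic to an open subset of the
half-space `ℝ^{n-1} × [0,∞)`. -/
def LocallyHalfSpace (n : ℕ) (M : Type*) [TopologicalSpace M] : Prop :=
  ∀ x : M, ∃ V : Set M, IsOpen V ∧ x ∈ V ∧ HomeoToOpen V (HalfSpace n)

/-- The manifold boundary of a space: points with no open neighborhood homeomorphic to
an open subset of `ℝⁿ`. -/
def spaceBoundary (n : ℕ) (M : Type*) [TopologicalSpace M] : Set M :=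
  {x | ¬ ∃ V : Set M, IsOpen V ∧ x ∈ V ∧ HomeoToOpen V (EuclideanSpace ℝ (Fin n))}

variable {X : Type*} [TopologicalSpace X]

/-- A subset which is a compact `n`-manifold with boundary (subspace topology). -/
def IsCompactMfldBdry (n : ℕ) (N : Set X) : Prop :=
  IsCompact N ∧ LocallyHalfSpace n ↥N

/-- The boundary of a subset which is a manifold with boundary, as a subset of the
ambient space. -/
def subsetBoundary (n : ℕ) (N : Set X) : Set X :=
  Subtype.val '' spaceBoundary n ↥N

/-- `S` is bicollared in the ambient space. -/
def Bicollared (S : Set X) : Prop :=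
  ∃ b : ↥S × ↥(Set.Icc (-1 : ℝ) 1) → X,
    Topology.IsEmbedding b ∧ ∀ x : ↥S, b (x, ⟨0, by norm_num⟩) = (x : X)

/-- `M` and `N` (compact `n`-manifolds with boundary, `N ⊆ int M`) are concentric:
`M \ int N` is homeomorphic to `∂M × [0,1]`. -/
def Concentric (n : ℕ) (M N : Set X) : Prop :=
  Nonempty (↥(M \ interior N) ≃ₜ ↥(subsetBoundary n M) × ↥(Set.Icc (0 : ℝ) 1))

/-- `K` is a topological spine of the compact `n`-manifold with boundary `N`:
`K ⊆ int N` and `N \ K` is homeomorphic to `∂N × [0,∞)`. -/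
def IsSpine (n : ℕ) (N K : Set X) : Prop :=
  K ⊆ interior N ∧
    Nonempty (↥(N \ K) ≃ₜ ↥(subsetBoundary n N) × ↥(Set.Ici (0 : ℝ)))

/-- The ω-limit set of `Y` under a map `f`. -/
def omegaSet (f : X → X) (Y : Set X) : Set X :=
  ⋂ (n : ℕ) (_ : 1 ≤ n), closure (⋃ (k : ℕ) (_ : n ≤ k), f^[k] '' Y)

/-- `K` is an attractor of the homeomorphism `f`. -/
def IsAttractor (f : X ≃ₜ X) (K : Set X) : Prop :=
  IsCompact K ∧ ∃ U : Set X, U ∈ 𝓝ˢ K ∧ K = omegaSet f U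

/-- `K` is a repeller of the homeomorphism `f`. -/
def IsRepeller (f : X ≃ₜ X) (K : Set X) : Prop :=
  IsAttractor f.symm K

/-- A continuous family of homeomorphisms parametrized by the unit interval. -/
def ContinuousFamily {M : Type*} [TopologicalSpace M] (f : unitInterval → M ≃ₜ M) : Prop :=
  Continuous (fun p : unitInterval × M => f p.1 p.2) ∧
    Continuous (fun p : unitInterval × M => (f p.1).symm p.2)

/-- `M` has the concentric rigidity property (as a subset of the ambient space). -/
def ConcentricRigidity (n : ℕ) (M : Set X) : Prop :=
  ∀ M₀ M₁ : Set X, IsCompactMfldBdry n M₀ → IsCompactMfldBdry n M₁ →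
    M₀ ⊆ interior M₁ → M₁ ⊆ interior M →
    Bicollared (subsetBoundary n M₁) →
    Nonempty (↥(subsetBoundary n M₁) ≃ₜ ↥(subsetBoundary n M)) →
    Concentric n M M₀ →
    Concentric n M₁ M₀ ∧ Concentric n M M₁

section
open MeasureTheory

abbrev E3 := EuclideanSpace ℝ (Fin 3)

lemma det_poly (A : E3 →L[ℝ] E3) (t : ℝ) :
    ((1 : E3 →L[ℝ] E3) + t • A).det = 1 +
      (((1 + A).det - (1 + (-1:ℝ) • A).det) / 2 -
        ((1 + (2:ℝ) • A).det - 1 - 4 * (((1 + A).det + (1 + (-1:ℝ) • A).det) / 2 - 1)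
          - ((1 + A).det - (1 + (-1:ℝ) • A).det)) / 6) * t
      + (((1 + A).det + (1 + (-1:ℝ) • A).det) / 2 - 1) * t ^ 2
      + (((1 + (2:ℝ) • A).det - 1 - 4 * (((1 + A).det + (1 + (-1:ℝ) • A).det) / 2 - 1)
          - ((1 + A).det - (1 + (-1:ℝ) • A).det)) / 6) * t ^ 3 := by
  set b := (EuclideanSpace.basisFun (Fin 3) ℝ).toBasis
  have key : ∀ s : ℝ, ((1 : E3 →L[ℝ] E3) + s • A).det
      = (1 + s • LinearMap.toMatrix b b (A : E3 →ₗ[ℝ] E3)).det := by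
    intro s
    rw [ContinuousLinearMap.det, ← LinearMap.det_toMatrix b]
    congr 1
    simp [LinearMap.toMatrix_one]
  have k1 := key 1
  rw [one_smul, one_smul] at k1
  rw [key, key (-1), key 2, k1]
  generalize LinearMap.toMatrix b b (A : E3 →ₗ[ℝ] E3) = m
  simp [Matrix.det_fin_three]
  ring

lemma lip_glue (r : E3 → E3) (R : ℝ) (C : NNReal)
    (hr : LipschitzOnWith C r (Metric.closedBall 0 R)) (h0 : ∀ x, ‖x‖ = R → r x = 0) :
    ∀ x y, ‖(if ‖x‖ ≤ R then r x else 0) - (if ‖y‖ ≤ R then r y else 0)‖ ≤ C * ‖x - y‖ := by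
  have main : ∀ x y : E3, ‖x‖ ≤ R → R < ‖y‖ → ‖r x‖ ≤ C * ‖x - y‖ := by
    intro x y hx hy
    have hc : ContinuousOn (fun s : ℝ => ‖x + s • (y - x)‖) (Icc 0 1) := by fun_prop
    have := intermediate_value_Icc (zero_le_one) hc
    have hm : R ∈ Icc (‖x + (0:ℝ) • (y - x)‖) (‖x + (1:ℝ) • (y - x)‖) := by
      simp only [zero_smul, one_smul, add_zero, add_sub_cancel]; exact ⟨hx, hy.le⟩
    obtain ⟨s, hs, hsR⟩ := this hm
    simp only at hsR
    have h1 := hr.dist_le_mul x (by simpa using hx) (x + s • (y - x)) (by simp [hsR])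
    rw [h0 _ hsR, dist_zero_right] at h1
    refine h1.trans ?_
    gcongr
    rw [dist_eq_norm]
    have : x - (x + s • (y - x)) = s • (x - y) := by module
    rw [this, norm_smul, Real.norm_eq_abs, abs_of_nonneg hs.1]
    exact mul_le_of_le_one_left (norm_nonneg _) hs.2
  intro x y
  split_ifs with hx hy hy
  · have := hr.dist_le_mul x (by simpa using hx) y (by simpa using hy)
    simpa [dist_eq_norm] using this
  · simpa using main x y hx (not_le.1 hy)
  · rw [zero_sub, norm_neg, norm_sub_rev]; exact main y x hy (not_le.1 hx)
  · simp; positivity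

lemma homeo_small (v : E3 → E3) (C : ℝ) (hC : 0 ≤ C) (hv : ∀ x y, ‖v x - v y‖ ≤ C * ‖x - y‖)
    (t : ℝ) (ht : 0 ≤ t) (htC : t * C < 1) :
    Function.Bijective (fun x => x + t • v x) := by
  have hA : ApproximatesLinearOn (fun x => x + t • v x)
      ((ContinuousLinearEquiv.refl ℝ E3 : E3 ≃L[ℝ] E3) : E3 →L[ℝ] E3) univ
      (Real.toNNReal (t * C)) := by
    intro x _ y _
    have : x + t • v x - (y + t • v y) - (ContinuousLinearEquiv.refl ℝ E3 : E3 →L[ℝ] E3) (x - y)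
      = t • (v x - v y) := by
      simp; module
    rw [this, norm_smul, Real.norm_eq_abs, abs_of_nonneg ht]
    have := hv x y
    calc t * ‖v x - v y‖ ≤ t * (C * ‖x - y‖) := by gcongr
      _ = _ := by rw [Real.coe_toNNReal _ (by positivity)]; ring
  have hlt : (Real.toNNReal (t * C)) <
      ‖((ContinuousLinearEquiv.refl ℝ E3).symm : E3 →L[ℝ] E3)‖₊⁻¹ := by
    have : ‖((ContinuousLinearEquiv.refl ℝ E3).symm : E3 →L[ℝ] E3)‖₊ = 1 := by
      ext
      simp only [ContinuousLinearEquiv.refl_symm, ContinuousLinearEquiv.coe_refl, coe_nnnorm]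
      exact ContinuousLinearMap.norm_id
    rw [this, inv_one]
    exact Real.toNNReal_lt_one.2 htC
  have := (hA.toHomeomorph _ (Or.inr hlt)).bijective
  exact this

lemma det_zero_of_norm_const (r : E3 → E3) (R : ℝ) (hR : 0 < R) (hr : Differentiable ℝ r)
    (hn : ∀ x, ‖r x‖ = R) (x : E3) : (fderiv ℝ r x).det = 0 := by
  by_contra hne
  have hun : IsUnit ((fderiv ℝ r x : E3 →L[ℝ] E3) : E3 →ₗ[ℝ] E3).det := isUnit_iff_ne_zero.2 hne
  have hsurj : Function.Surjective (fderiv ℝ r x) := by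
    have := (LinearMap.isUnit_iff_isUnit_det _).2 hun
    exact ((Module.End.isUnit_iff _).1 this).2
  obtain ⟨u, hu⟩ := hsurj (r x)
  have hconst : HasFDerivAt (fun y => ‖r y‖^2) (0 : E3 →L[ℝ] ℝ) x := by
    simp_rw [hn]; exact hasFDerivAt_const _ _
  have h2 := (hr x).hasFDerivAt.norm_sq
  have := congrArg (fun L => L u) (hconst.unique h2)
  simp [hu, hn] at this
  exact hR.ne' this

set_option maxHeartbeats 1000000 in
lemma no_retract (r : E3 → E3) (R : ℝ) (hR : 0 < R) (hr : ContDiff ℝ 1 r)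
    (hn : ∀ x, ‖r x‖ = R) (hid : ∀ x, ‖x‖ = R → r x = x) : False := by
  set w : E3 → E3 := fun x => r x - x with hw
  have hwd : ContDiff ℝ 1 w := hr.sub contDiff_id
  have hcb : IsCompact (Metric.closedBall (0:E3) R) := isCompact_closedBall _ _
  have hAc : Continuous (fderiv ℝ w) := hwd.continuous_fderiv (by norm_num)
  obtain ⟨C, hC⟩ := hcb.exists_bound_of_continuousOn hAc.continuousOn
  have hlip : LipschitzOnWith (Real.toNNReal C) w (Metric.closedBall 0 R) := by
    apply Convex.lipschitzOnWith_of_nnnorm_fderiv_le (𝕜 := ℝ)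
    · intro x _; exact (hwd.differentiable (by norm_num)) x
    · intro x hx
      exact NNReal.le_toNNReal_of_coe_le (hC x hx)
    · exact convex_closedBall _ _
  set v : E3 → E3 := fun x => if ‖x‖ ≤ R then w x else 0 with hv
  have hvL := lip_glue w R _ hlip (by intro x hx; simp [hw, hid x hx])
  set C' : ℝ := (Real.toNNReal C : ℝ)
  have hC' : 0 ≤ C' := NNReal.coe_nonneg _
  set A := fderiv ℝ w
  set a : E3 → ℝ := fun x => (((1 + A x).det - (1 + (-1:ℝ) • A x).det) / 2 -
        ((1 + (2:ℝ) • A x).det - 1 - 4 * (((1 + A x).det + (1 + (-1:ℝ) • A x).det) / 2 - 1)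
          - ((1 + A x).det - (1 + (-1:ℝ) • A x).det)) / 6) with ha
  set b : E3 → ℝ := fun x => (((1 + A x).det + (1 + (-1:ℝ) • A x).det) / 2 - 1) with hb
  set c : E3 → ℝ := fun x => (((1 + (2:ℝ) • A x).det - 1 - 4 * (((1 + A x).det + (1 + (-1:ℝ) • A x).det) / 2 - 1)
          - ((1 + A x).det - (1 + (-1:ℝ) • A x).det)) / 6) with hc
  have hdet : Continuous (fun B : E3 →L[ℝ] E3 => B.det) := ContinuousLinearMap.continuous_det
  have d1 : Continuous (fun x => (1 + A x).det) := hdet.comp (by fun_prop)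
  have d2 : ∀ s : ℝ, Continuous (fun x => (1 + s • A x).det) := fun s => hdet.comp (by fun_prop)
  have ca : Continuous a := by have := d2 2; have := d2 (-1); fun_prop
  have cb : Continuous b := by have := d2 (-1); fun_prop
  have cc : Continuous c := by have := d2 2; have := d2 (-1); fun_prop
  obtain ⟨Ba, hBa⟩ := hcb.exists_bound_of_continuousOn ca.continuousOn
  obtain ⟨Bb, hBb⟩ := hcb.exists_bound_of_continuousOn cb.continuousOn
  obtain ⟨Bc, hBc⟩ := hcb.exists_bound_of_continuousOn cc.continuousOn
  have h0m : (0:E3) ∈ Metric.closedBall (0:E3) R := by simp [hR.le]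
  have Ba0 : 0 ≤ Ba := (norm_nonneg _).trans (hBa 0 h0m)
  have Bb0 : 0 ≤ Bb := (norm_nonneg _).trans (hBb 0 h0m)
  have Bc0 : 0 ≤ Bc := (norm_nonneg _).trans (hBc 0 h0m)
  set B := Metric.ball (0:E3) R
  have hBsub : B ⊆ Metric.closedBall (0:E3) R := Metric.ball_subset_closedBall
  have ia : IntegrableOn a B := (ca.continuousOn.integrableOn_compact hcb).mono_set hBsub
  have ib : IntegrableOn b B := (cb.continuousOn.integrableOn_compact hcb).mono_set hBsub
  have ic : IntegrableOn c B := (cc.continuousOn.integrableOn_compact hcb).mono_set hBsub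
  have hvolfin : volume B ≠ ⊤ := measure_ball_lt_top.ne
  have i1 : IntegrableOn (fun _ : E3 => (1:ℝ)) B := integrableOn_const hvolfin
  have hint : ∀ t : ℝ, ∫ x in B, (1 + t • A x).det
      = (volume B).toReal + (∫ x in B, a x) * t + (∫ x in B, b x) * t^2 + (∫ x in B, c x) * t^3 := by
    intro t
    have : ∀ x, (1 + t • A x).det = 1 + a x * t + b x * t^2 + c x * t^3 := fun x => det_poly (A x) t
    simp_rw [this]
    rw [integral_add, integral_add, integral_add, integral_mul_const, integral_mul_const, integral_mul_const]
    · simp [Measure.real]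
    · exact i1
    · exact ia.mul_const _
    · exact Integrable.add i1 (ia.mul_const _)
    · exact ib.mul_const _
    · exact Integrable.add (Integrable.add i1 (ia.mul_const _)) (ib.mul_const _)
    · exact ic.mul_const _
  set D := C' + Ba + Bb + Bc + 1 with hD
  have hDpos : 0 < D := by positivity
  have small : ∀ t : ℝ, 0 < t → t ≤ 1 → t * D ≤ 1 → (∫ x in B, a x) * t + (∫ x in B, b x) * t^2 + (∫ x in B, c x) * t^3 = 0 := by
    intro t ht ht1 htD
    have hbij := homeo_small v C' hC' hvL t ht.le (by nlinarith)
    set g : E3 → E3 := fun x => x + t • v x with hg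
    have hgout : ∀ x, x ∉ B → g x = x := by
      intro x hx
      have hx' : R ≤ ‖x‖ := by simpa [B] using hx
      rcases hx'.eq_or_lt with h | h
      · simp [hg, hv, hw, hid x h.symm]
      · simp [hg, hv, not_le.2 h]
    have himg : g '' B = B := by
      have : g '' Bᶜ = Bᶜ := by
        ext y; constructor
        · rintro ⟨x, hx, rfl⟩; rw [hgout x hx]; exact hx
        · intro hy; exact ⟨y, hy, hgout y hy⟩
      rw [Set.image_compl_eq hbij] at this
      exact compl_injective this
    have hder : ∀ x ∈ B, HasFDerivWithinAt g (1 + t • A x) B x := by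
      intro x hx
      have h1 : HasFDerivAt (fun x => x + t • w x) (1 + t • A x) x := by
        have := ((hwd.differentiable (by norm_num)) x).hasFDerivAt
        exact (hasFDerivAt_id x).add (this.const_smul t)
      refine h1.hasFDerivWithinAt.congr ?_ ?_
      · intro y hy
        have : ‖y‖ ≤ R := by simpa using hBsub hy
        simp [hg, hv, this]
      · have : ‖x‖ ≤ R := by simpa using hBsub hx
        simp [hg, hv, this]
    have hcv := lintegral_abs_det_fderiv_eq_addHaar_image volume Metric.isOpen_ball.measurableSet hder (hbij.1.injOn)
    rw [himg] at hcv
    have hpos : ∀ x ∈ B, 0 ≤ (1 + t • A x).det := by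
      intro x hx
      rw [show (1 + t • A x).det = 1 + a x * t + b x * t^2 + c x * t^3 from det_poly (A x) t]
      have h1 := abs_le.1 (hBa x (hBsub hx))
      have h2 := abs_le.1 (hBb x (hBsub hx))
      have h3 := abs_le.1 (hBc x (hBsub hx))
      have e2 : t^2 ≤ t := by nlinarith
      have e3 : t^3 ≤ t := by nlinarith [mul_nonneg ht.le (sub_nonneg.2 e2)]
      have f1 : - (Ba * t) ≤ a x * t := by nlinarith
      have f2 : - (Bb * t) ≤ b x * t^2 := by nlinarith [sq_nonneg t]
      have f3 : - (Bc * t) ≤ c x * t^3 := by nlinarith [pow_pos ht 3]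
      nlinarith
    have hd2 := d2 t
    have hre : ∫ x in B, (1 + t • A x).det = (volume B).toReal := by
      rw [integral_eq_lintegral_of_nonneg_ae, ← hcv]
      · congr 1
        refine setLIntegral_congr_fun Metric.isOpen_ball.measurableSet ?_
        intro x hx
        simp only [abs_of_nonneg (hpos x hx)]
      · exact (ae_restrict_iff' Metric.isOpen_ball.measurableSet).2 (Filter.Eventually.of_forall hpos)
      · exact hd2.aestronglyMeasurable
    linarith [hint t]
  set t := min 1 (1 / D)
  have ht0 : 0 < t := by positivity
  have ht1 : t ≤ 1 := min_le_left _ _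
  have htD : t * D ≤ 1 := by
    calc t * D ≤ 1 / D * D := by gcongr; exact min_le_right _ _
      _ = 1 := by field_simp
  have s1 := small t ht0 ht1 htD
  have s2 := small (t/2) (by positivity) (by linarith) (by nlinarith)
  have s3 := small (t/3) (by positivity) (by linarith) (by nlinarith)
  have hz := hint 1
  generalize (∫ x in B, a x) = x1 at *
  generalize (∫ x in B, b x) = x2 at *
  generalize (∫ x in B, c x) = x3 at *
  have q1 : x1 + x2 * t + x3 * t^2 = 0 := by
    have : t * (x1 + x2 * t + x3 * t^2) = 0 := by linarith
    exact (mul_eq_zero.1 this).resolve_left ht0.ne'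
  have q2 : x1 + x2 * (t/2) + x3 * (t/2)^2 = 0 := by
    have : (t/2) * (x1 + x2 * (t/2) + x3 * (t/2)^2) = 0 := by linarith
    exact (mul_eq_zero.1 this).resolve_left (by positivity)
  have q3 : x1 + x2 * (t/3) + x3 * (t/3)^2 = 0 := by
    have : (t/3) * (x1 + x2 * (t/3) + x3 * (t/3)^2) = 0 := by linarith
    exact (mul_eq_zero.1 this).resolve_left (by positivity)
  have z3 : x3 = 0 := by
    have : x3 * t^2 = 0 := by linarith
    exact (mul_eq_zero.1 this).resolve_right (by positivity)
  subst z3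
  have z2 : x2 = 0 := by
    have : x2 * t = 0 := by linarith
    exact (mul_eq_zero.1 this).resolve_right (by positivity)
  subst z2
  have z1 : x1 = 0 := by linarith
  subst z1
  have hdz : ∀ x, (1 + (1:ℝ) • A x).det = 0 := by
    intro x
    have hAx : 1 + (1:ℝ) • A x = fderiv ℝ r x := by
      have : A x = fderiv ℝ r x - 1 := by
        have h := ((hr.differentiable (by norm_num)) x).hasFDerivAt.sub (hasFDerivAt_id x)
        exact h.fderiv
      rw [this, one_smul, add_sub_cancel]
    rw [hAx]
    exact det_zero_of_norm_const r R hR (hr.differentiable (by norm_num)) hn x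
  simp_rw [hdz] at hz
  simp at hz
  have := Metric.measure_ball_pos volume (0:E3) hR
  exact (ENNReal.toReal_pos this.ne' hvolfin).ne' hz.symm

lemma zero_of_bounded (e : E3 → E3) (he : Continuous e) (hb : ∀ x, ‖e x‖ ≤ 1) :
    ∃ x, x + e x = 0 := by
  by_contra hne
  push Not at hne
  have hcb : IsCompact (Metric.closedBall (0:E3) 3) := isCompact_closedBall _ _
  obtain ⟨m, hm, hmin⟩ := hcb.exists_isMinOn (f := fun x => ‖x + e x‖) ⟨0, by simp⟩
    (by fun_prop)
  set κ := min (‖m + e m‖) 1 / 2 with hκ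
  have hκ0 : 0 < κ := by
    have := norm_pos_iff.2 (hne m)
    positivity
  have hκ1 : κ ≤ 1 / 2 := by
    have := min_le_right (‖m + e m‖) 1
    linarith
  have hκm : ∀ x, ‖x‖ ≤ 3 → 2 * κ ≤ ‖x + e x‖ := by
    intro x hx
    have h1 : ‖m + e m‖ ≤ ‖x + e x‖ := hmin (by simpa using hx)
    have := min_le_left (‖m + e m‖) 1
    linarith
  obtain ⟨e', he', happ, -⟩ := he.exists_contDiff_approx 1 (ε := fun _ => κ) continuous_const (fun _ => hκ0)
  set χ : ContDiffBump (0:E3) := ⟨2, 3, by norm_num, by norm_num⟩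
  set h : E3 → E3 := fun x => x + χ x • e' x with hh
  have hcd : ContDiff ℝ 1 h := contDiff_id.add (χ.contDiff.smul he')
  have hne' : ∀ x, h x ≠ 0 := by
    intro x h0
    have ha : ‖e' x - e x‖ < κ := by simpa [dist_eq_norm] using happ x
    have hbd : ‖e' x‖ ≤ 1 + κ := by
      calc ‖e' x‖ = ‖(e' x - e x) + e x‖ := by simp
        _ ≤ _ := norm_add_le _ _
        _ ≤ _ := by linarith [hb x]
    by_cases hx : ‖x‖ ≤ 2
    · have h1 : χ x = 1 := χ.one_of_mem_closedBall (by simpa using hx)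
      have h2 := hκm x (by linarith)
      have h3 : x + e x = h x - (e' x - e x) := by simp only [hh, h1, one_smul]; abel
      rw [h3, h0, zero_sub, norm_neg] at h2
      linarith
    · push Not at hx
      have h1 : x = - (χ x • e' x) := eq_neg_of_add_eq_zero_left h0
      have h2 : ‖x‖ ≤ 1 + κ := by
        rw [h1, norm_neg, norm_smul, Real.norm_eq_abs, abs_of_nonneg χ.nonneg]
        calc _ ≤ 1 * ‖e' x‖ := by gcongr; exact χ.le_one
          _ ≤ _ := by linarith
      linarith
  refine no_retract (fun x => (3 * ‖h x‖⁻¹) • h x) 3 (by norm_num) ?_ ?_ ?_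
  · exact (contDiff_const.mul ((hcd.norm ℝ hne').inv (fun x => norm_ne_zero_iff.2 (hne' x)))).smul hcd
  · intro x
    have := norm_pos_iff.2 (hne' x)
    rw [norm_smul]; simp; field_simp
  · intro x hx
    have h1 : χ x = 0 := χ.zero_of_le_dist (by simp [hx, χ])
    simp [hh, h1, hx]

lemma id_core (f : E3 → E3) (hf : ContinuousOn f (Metric.closedBall 0 1))
    (hi : InjOn f (Metric.closedBall 0 1)) : f '' (Metric.closedBall 0 1) ∈ 𝓝 (f 0) := by
  set cB := Metric.closedBall (0:E3) 1 with hcB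
  have hcomp : IsCompact cB := isCompact_closedBall _ _
  have h0 : (0:E3) ∈ cB := by simp [hcB]
  have : CompactSpace cB := isCompact_iff_compactSpace.1 hcomp
  have hemb : IsClosedEmbedding (fun x : cB => f x) :=
    (continuousOn_iff_continuous_domRestrict.1 hf).isClosedEmbedding
      (fun x y h => Subtype.ext (hi x.2 y.2 h))
  obtain ⟨G, hG⟩ := ContinuousMap.exists_extension (Y := E3) hemb ⟨fun x : cB => (x:E3), continuous_subtype_val⟩
  have hGf : ∀ x ∈ cB, G (f x) = x := fun x hx => congrArg (fun g => g ⟨x, hx⟩) hG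
  by_contra hno
  have hG0 : G (f 0) = 0 := hGf 0 h0
  obtain ⟨ρ, hρ, hGρ⟩ := Metric.continuous_iff.1 G.continuous (f 0) (1/10) (by norm_num)
  rw [hG0] at hGρ
  set ε := ρ / 2
  have hε : 0 < ε := by positivity
  obtain ⟨c, hc, hcS⟩ : ∃ c, dist c (f 0) < ε ∧ c ∉ f '' cB := by
    by_contra hcon
    push Not at hcon
    exact hno (Filter.mem_of_superset (Metric.ball_mem_nhds _ hε) (fun y hy => hcon y hy))
  have hScomp : IsCompact (f '' cB) := hcomp.image_of_continuousOn hf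
  set S1 := f '' cB ∩ (Metric.ball c ε)ᶜ
  have hS1 : IsCompact S1 := hScomp.inter_right Metric.isOpen_ball.isClosed_compl
  obtain ⟨δ, hδ0, hδ1, hδ⟩ : ∃ δ > 0, δ ≤ 1/10 ∧ ∀ y ∈ S1, δ ≤ ‖G y‖ := by
    rcases S1.eq_empty_or_nonempty with he | hne
    · exact ⟨1/10, by norm_num, le_rfl, by simp [he]⟩
    · obtain ⟨m, hm, hmin⟩ := hS1.exists_isMinOn (f := fun y => ‖G y‖) hne (by fun_prop)
      have : 0 < ‖G m‖ := by
        rw [norm_pos_iff]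
        intro h
        obtain ⟨⟨x, hx, rfl⟩, hmb⟩ := hm
        rw [hGf x hx] at h
        subst h
        exact hmb (by rw [Metric.mem_ball, dist_comm]; exact hc)
      refine ⟨min ‖G m‖ (1/10), by positivity, min_le_right _ _, fun y hy => ?_⟩
      exact (min_le_left _ _).trans (hmin hy)
  obtain ⟨P, hP, happ, -⟩ := G.continuous.exists_contDiff_approx 1 (ε := fun _ => δ/4) continuous_const (fun _ => by positivity)
  have hnull : volume (P '' Metric.sphere c ε) = 0 :=
    addHaar_image_eq_zero_of_differentiableOn_of_addHaar_eq_zero volume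
      ((hP.differentiable (by norm_num)).differentiableOn) (Measure.addHaar_sphere _ _ _)
  obtain ⟨z, hz, hzP⟩ : ∃ z, ‖z‖ < δ/4 ∧ z ∉ P '' Metric.sphere c ε := by
    by_contra hcon
    push Not at hcon
    have : volume (Metric.ball (0:E3) (δ/4)) ≤ 0 := by
      rw [← hnull]; exact measure_mono (fun y hy => hcon y (by simpa using hy))
    exact absurd (Metric.measure_ball_pos volume (0:E3) (by positivity : 0 < δ/4)) (not_lt.2 this)
  set P' : E3 → E3 := fun y => P y - z with hP'
  have hPc : Continuous P' := hP.continuous.sub continuous_const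
  have hPG : ∀ y, ‖P' y - G y‖ ≤ δ/2 := by
    intro y
    have h1 : ‖P y - G y‖ < δ/4 := by simpa [dist_eq_norm] using happ y
    calc ‖P' y - G y‖ = ‖(P y - G y) - z‖ := by simp only [hP']; congr 1; abel
      _ ≤ _ := norm_sub_le _ _
      _ ≤ _ := by linarith
  set Φ : E3 → E3 := fun y => c + (max 1 (ε / ‖y - c‖)) • (y - c) with hΦ
  have hne : ∀ x ∈ cB, f x - c ≠ 0 := fun x hx h => hcS ⟨x, hx, sub_eq_zero.1 h⟩
  have hΦ1 : ∀ y, ε ≤ ‖y - c‖ → Φ y = y := by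
    intro y hy
    have : ε / ‖y - c‖ ≤ 1 := div_le_one_of_le₀ hy (norm_nonneg _)
    simp [hΦ, max_eq_left this]
  have hΦ2 : ∀ y, y - c ≠ 0 → ‖y - c‖ < ε → Φ y ∈ Metric.sphere c ε := by
    intro y hy hy'
    have hp := norm_pos_iff.2 hy
    have : 1 ≤ ε / ‖y - c‖ := (one_le_div hp).2 hy'.le
    simp only [hΦ, max_eq_right this, Metric.mem_sphere, dist_eq_norm, add_sub_cancel_left]
    rw [norm_smul, Real.norm_eq_abs, abs_of_nonneg (by positivity)]
    field_simp
  set Q : E3 → E3 := fun x => P' (Φ (f x)) with hQ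
  have hQc : ContinuousOn Q cB := by
    refine hPc.comp_continuousOn ?_
    have h1 : ContinuousOn (fun x => f x - c) cB := hf.sub continuousOn_const
    have h2 : ContinuousOn (fun x => max 1 (ε / ‖f x - c‖)) cB :=
      ContinuousOn.sup continuousOn_const (continuousOn_const.div h1.norm
        (fun x hx => norm_ne_zero_iff.2 (hne x hx)))
    exact continuousOn_const.add (h2.smul h1)
  have hQ0 : ∀ x ∈ cB, Q x ≠ 0 ∧ ‖Q x - x‖ ≤ 1 := by
    intro x hx
    rcases le_or_gt ε ‖f x - c‖ with h | h
    · have e1 : Q x = P' (f x) := by simp only [hQ, hΦ1 _ h]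
      have hin : f x ∈ S1 := ⟨⟨x, hx, rfl⟩, by simp [dist_eq_norm, h]⟩
      have h2 := hδ _ hin
      have h3 := hPG (f x)
      rw [e1]
      constructor
      · intro h0
        rw [h0, zero_sub, norm_neg] at h3
        linarith
      · rw [hGf x hx] at h3; linarith
    · have h1 := hΦ2 _ (hne x hx) h
      constructor
      · intro h0
        exact hzP ⟨_, h1, sub_eq_zero.1 h0⟩
      · have d1 : dist (Φ (f x)) (f 0) < ρ := by
          calc _ ≤ dist (Φ (f x)) c + dist c (f 0) := dist_triangle _ _ _
            _ < ε + ε := by rw [Metric.mem_sphere.1 h1]; linarith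
            _ = ρ := by simp [ε]
        have d2 : dist (f x) (f 0) < ρ := by
          calc _ ≤ dist (f x) c + dist c (f 0) := dist_triangle _ _ _
            _ < ε + ε := by rw [dist_eq_norm]; linarith
            _ = ρ := by simp [ε]
        have g1 := hGρ _ d1
        have g2 := hGρ _ d2
        rw [hGf x hx] at g2
        rw [dist_zero_right] at g1 g2
        have g3 := hPG (Φ (f x))
        calc ‖Q x - x‖ = ‖(P' (Φ (f x)) - G (Φ (f x))) + G (Φ (f x)) - x‖ := by simp [hQ]
          _ ≤ ‖(P' (Φ (f x)) - G (Φ (f x))) + G (Φ (f x))‖ + ‖x‖ := norm_sub_le _ _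
          _ ≤ ‖P' (Φ (f x)) - G (Φ (f x))‖ + ‖G (Φ (f x))‖ + ‖x‖ := by gcongr; exact norm_add_le _ _
          _ ≤ 1 := by linarith
  set π : E3 → E3 := fun x => (max 1 ‖x‖)⁻¹ • x with hπ
  have hmx : ∀ x : E3, 0 < max 1 ‖x‖ := fun x => lt_of_lt_of_le one_pos (le_max_left _ _)
  have hπc : Continuous π := by
    refine Continuous.smul (Continuous.inv₀ (by fun_prop) (fun x => (hmx x).ne')) continuous_id
  have hπB : ∀ x, π x ∈ cB := by
    intro x
    rw [hcB, mem_closedBall_zero_iff, hπ]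
    simp only [norm_smul, norm_inv, Real.norm_eq_abs, abs_of_pos (hmx x)]
    rw [inv_mul_le_one₀ (hmx x)]
    exact le_max_right _ _
  obtain ⟨x, hx⟩ := zero_of_bounded (fun x => Q (π x) - π x)
    ((hQc.comp_continuous hπc hπB).sub hπc) (fun x => (hQ0 _ (hπB x)).2)
  have hx1 : ‖x‖ ≤ 1 := by
    rw [eq_neg_of_add_eq_zero_left hx, norm_neg]; exact (hQ0 _ (hπB x)).2
  have hπx : π x = x := by simp [hπ, max_eq_left hx1]
  rw [hπx] at hx
  exact (hQ0 x (by simpa [hcB] using hx1)).1 (by simpa using hx)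

lemma invariance_of_domain (f : E3 → E3) (O : Set E3) (hO : IsOpen O) (hf : ContinuousOn f O)
    (hi : InjOn f O) : IsOpen (f '' O) := by
  rw [isOpen_iff_mem_nhds]
  rintro _ ⟨x, hx, rfl⟩
  obtain ⟨ρ, hρ, hsub⟩ := Metric.nhds_basis_closedBall.mem_iff.1 (hO.mem_nhds hx)
  have hmem : ∀ y ∈ Metric.closedBall (0:E3) 1, x + ρ • y ∈ O := by
    intro y hy
    apply hsub
    have : ‖y‖ ≤ 1 := by simpa using hy
    simp only [Metric.mem_closedBall, dist_eq_norm, add_sub_cancel_left, norm_smul, Real.norm_eq_abs, abs_of_pos hρ]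
    nlinarith
  have := id_core (fun y => f (x + ρ • y)) (hf.comp (by fun_prop) hmem) (by
    intro y hy z hz h
    have := hi (hmem y hy) (hmem z hz) h
    exact smul_right_injective _ hρ.ne' (add_left_cancel this))
  simp only [smul_zero, add_zero] at this
  refine Filter.mem_of_superset this ?_
  rintro _ ⟨y, hy, rfl⟩
  exact ⟨_, hmem y hy, rfl⟩

end

lemma exists_stretch (a p q d : ℝ) (hap : a < p) (hpq : p ≤ q) (hqd : q < d) :
    ∃ sg : ℝ ≃o ℝ, sg p = q ∧ (∀ t, t ≤ a → sg t = t) ∧ (∀ t, d ≤ t → sg t = t) ∧ ∀ t, t ≤ sg t := by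
  set α := (q - p) / (p - a) with hα
  set γ := (q - p) / (d - p) with hγ
  have h1 : 0 < p - a := by linarith
  have h2 : 0 < d - p := by linarith
  have hα0 : 0 ≤ α := div_nonneg (by linarith) h1.le
  have hγ0 : 0 ≤ γ := div_nonneg (by linarith) h2.le
  have hγ1 : γ < 1 := (div_lt_one h2).2 (by linarith)
  have ea : α * (p - a) = q - p := by rw [hα]; field_simp
  have eg : γ * (d - p) = q - p := by rw [hγ]; field_simp
  set s : ℝ → ℝ := fun t => max t (min (t + α * (t - a)) (t + γ * (d - t))) with hs
  have hmono : StrictMono s := by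
    intro t u htu
    refine max_lt_max htu (min_lt_min ?_ ?_) <;> nlinarith
  have hlo : ∀ t, t ≤ a → s t = t := by
    intro t ht
    refine max_eq_left ((min_le_left _ _).trans ?_)
    nlinarith
  have hhi : ∀ t, d ≤ t → s t = t := by
    intro t ht
    refine max_eq_left ((min_le_right _ _).trans ?_)
    nlinarith
  have hc : Continuous s := by fun_prop
  have hsurj : Function.Surjective s := by
    apply hc.surjective
    · refine Filter.tendsto_id.congr' ?_
      filter_upwards [Filter.eventually_ge_atTop d] with t ht using (hhi t ht).symm
    · refine Filter.tendsto_id.congr' ?_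
      filter_upwards [Filter.eventually_le_atBot a] with t ht using (hlo t ht).symm
  refine ⟨hmono.orderIsoOfSurjective s hsurj, ?_, hlo, hhi, fun t => le_max_left _ _⟩
  change s p = q
  simp only [hs, ea, eg, min_self]
  rw [max_eq_right] <;> linarith

section eng
variable {M : Type*} [TopologicalSpace M] [T2Space M] {B : Type*} [TopologicalSpace B]
  [CompactSpace B]

lemma extend_cont (e : B × ℝ → M) (he : IsOpenEmbedding e) (a d : ℝ) (τ : (B × ℝ) ≃ₜ (B × ℝ))
    (hτ : ∀ z, z.2 ∉ Icc a d → τ z = z) (s : M → M) (h1 : ∀ z, s (e z) = e (τ z))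
    (h2 : ∀ x, x ∉ range e → s x = x) : Continuous s := by
  rw [continuous_iff_continuousAt]
  intro x
  by_cases hx : x ∈ range e
  · obtain ⟨z, rfl⟩ := hx
    rw [← he.continuousAt_iff]
    have : s ∘ e = e ∘ τ := funext h1
    rw [this]
    exact (he.continuous.comp τ.continuous).continuousAt
  · have hcl : IsClosed (e '' (univ ×ˢ Icc a d)) :=
      ((isCompact_univ.prod isCompact_Icc).image he.continuous).isClosed
    have hmem : (e '' (univ ×ˢ Icc a d))ᶜ ∈ 𝓝 x :=
      hcl.isOpen_compl.mem_nhds (fun ⟨z, _, hz⟩ => hx ⟨z, hz⟩)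
    refine continuousAt_id.congr ?_
    filter_upwards [hmem] with y hy
    by_cases hy' : y ∈ range e
    · obtain ⟨z, rfl⟩ := hy'
      rw [h1, hτ z]
      · rfl
      · intro hz; exact hy ⟨z, ⟨mem_univ _, hz⟩, rfl⟩
    · exact (h2 y hy').symm

lemma stretch_homeo (e : B × ℝ → M) (he : IsOpenEmbedding e) (a d : ℝ) (sg : ℝ ≃o ℝ)
    (hlo : ∀ t, t ≤ a → sg t = t) (hhi : ∀ t, d ≤ t → sg t = t) :
    ∃ s : M ≃ₜ M, (∀ y t, s (e (y, t)) = e (y, sg t)) ∧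
      ∀ x, x ∉ e '' (univ ×ˢ Icc a d) → s x = x := by
  classical
  set τ : (B × ℝ) ≃ₜ (B × ℝ) := (Homeomorph.refl B).prodCongr sg.toHomeomorph with hτ
  have hτ1 : ∀ z : B × ℝ, z.2 ∉ Icc a d → τ z = z := by
    rintro ⟨y, t⟩ hz
    have : sg t = t := by
      by_cases h : t ≤ a
      · exact hlo t h
      · by_cases h' : d ≤ t
        · exact hhi t h'
        · exact absurd ⟨(not_le.1 h).le, (not_le.1 h').le⟩ hz
    simp [hτ, this]
  have hτ2 : ∀ z : B × ℝ, z.2 ∉ Icc a d → τ.symm z = z := by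
    intro z hz
    rw [Homeomorph.symm_apply_eq]; exact (hτ1 z hz).symm
  set E := Equiv.ofInjective e he.injective
  set s : Equiv.Perm M := Equiv.Perm.extendDomain (τ.toEquiv : Equiv.Perm (B × ℝ)) E with hs
  have k1 : ∀ z, s (e z) = e (τ z) := fun z => Equiv.Perm.extendDomain_apply_image _ E z
  have k2 : ∀ x, x ∉ range e → s x = x := fun x hx =>
    Equiv.Perm.extendDomain_apply_not_subtype _ E hx
  have k3 : ∀ z, s.symm (e z) = e (τ.symm z) := by
    intro z; rw [Equiv.symm_apply_eq, k1]; simp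
  have k4 : ∀ x, x ∉ range e → s.symm x = x := by
    intro x hx; rw [Equiv.symm_apply_eq, k2 x hx]
  refine ⟨⟨s, extend_cont e he a d τ hτ1 s k1 k2, extend_cont e he a d τ.symm hτ2 s.symm k3 k4⟩,
    fun y t => k1 (y, t), ?_⟩
  intro x hx
  by_cases hx' : x ∈ range e
  · obtain ⟨z, rfl⟩ := hx'
    change s (e z) = e z
    rw [k1, hτ1]
    intro h; exact hx ⟨z, ⟨mem_univ _, h⟩, rfl⟩
  · exact k2 x hx'

lemma image_eq_of_fix (s : M ≃ₜ M) (U S : Set M) (hS : S ⊆ U) (h : ∀ x, x ∉ S → s x = x) :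
    s '' U = U := by
  have key : ∀ x ∈ U, s x ∈ U := by
    intro x hx
    by_cases hxS : x ∈ S
    · by_contra hn
      have h1 := h (s x) (fun hh => hn (hS hh))
      have := s.injective h1
      rw [this] at hn; exact hn hx
    · rw [h x hxS]; exact hx
  apply Subset.antisymm
  · rintro _ ⟨x, hx, rfl⟩; exact key x hx
  · intro x hx
    refine ⟨s.symm x, ?_, by simp⟩
    by_contra hn
    have := h (s.symm x) (fun hh => hn (hS hh))
    simp at this
    rw [← this] at hn; exact hn hx

lemma compact_bound (D : Set ℝ) (hD : IsCompact D) (t1 : ℝ) (h : ∀ t ∈ D, t < t1) :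
    ∃ T < t1, ∀ t ∈ D, t ≤ T := by
  rcases D.eq_empty_or_nonempty with rfl | hne
  · exact ⟨t1 - 1, by linarith, by simp⟩
  · obtain ⟨m, hm, hg⟩ := hD.exists_isGreatest hne
    exact ⟨m, h m hm, fun t ht => hg ht⟩

lemma collar_union (β : B × ℝ → M) (hβ : IsOpenEmbedding β) (U : Set M) (t0 τ t1 : ℝ)
    (h0τ : t0 < τ) (hτ1 : τ < t1)
    (hU1 : ∀ y t, t0 ≤ t → t < t1 → β (y, t) ∈ U) (hU2 : ∀ y t, t < t0 → β (y, t) ∉ U)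
    (Q : ℕ → Set M) (hQc : ∀ i, IsCompact (Q i)) (hQU : ∀ i, Q i ⊆ U)
    (hex : ∀ L ⊆ U, IsCompact L → ∃ i, L ⊆ Q i)
    (hE : ∀ i, ∃ h : M ≃ₜ M, h '' U = U ∧ (∀ y t, t ≤ τ → h (β (y, t)) = β (y, t)) ∧
      ∀ x ∈ Q i, ∃ y t, t0 ≤ t ∧ t < t1 ∧ x = h (β (y, t))) :
    Nonempty (U ≃ₜ B × Ici (0:ℝ)) := by
  -- improved engulfing
  have hE' : ∀ T < t1, ∀ L ⊆ U, IsCompact L → ∃ h : M ≃ₜ M, h '' U = U ∧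
      (∀ y t, t ≤ T → h (β (y, t)) = β (y, t)) ∧
      ∀ x ∈ L, ∃ y t, t0 ≤ t ∧ t < t1 ∧ x = h (β (y, t)) := by
    intro T' hT' L hL hLc
    set T := max T' τ
    have hT : T < t1 := max_lt hT' hτ1
    have hTτ : τ ≤ T := le_max_right _ _
    obtain ⟨sg, hsgp, hsglo, hsghi, hsgge⟩ := exists_stretch t0 τ T ((T + t1)/2) h0τ hTτ (by linarith)
    obtain ⟨s, hs1, hs2⟩ := stretch_homeo β hβ t0 ((T + t1)/2) sg hsglo hsghi
    have hsU : s '' U = U := by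
      refine image_eq_of_fix s U _ ?_ hs2
      rintro _ ⟨⟨y, t⟩, ⟨-, ht⟩, rfl⟩
      have := ht.2
      exact hU1 y t ht.1 (by simp only at this; linarith)
    have hsU' : s.symm '' U = U := by
      conv_lhs => rw [← hsU]
      rw [← image_comp]; simp
    obtain ⟨i, hi⟩ := hex (s.symm '' L) (by rw [← hsU']; exact image_mono hL)
      (hLc.image s.symm.continuous)
    obtain ⟨h', hh1, hh2, hh3⟩ := hE i
    refine ⟨(s.symm.trans h').trans s, ?_, ?_, ?_⟩
    · have : ⇑((s.symm.trans h').trans s) = s ∘ h' ∘ s.symm := rfl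
      rw [this, image_comp, image_comp, hsU', hh1, hsU]
    · intro y t ht
      have hst : s.symm (β (y, t)) = β (y, sg.symm t) := by
        rw [Homeomorph.symm_apply_eq, hs1]; simp
      have hle : sg.symm t ≤ τ := by
        rw [← sg.le_iff_le, hsgp]; simp only [OrderIso.apply_symm_apply]
        exact ht.trans (le_max_left _ _)
      simp only [Homeomorph.trans_apply, hst, hh2 _ _ hle, hs1]
      simp
    · intro x hx
      obtain ⟨y, t, ht0, ht1, hxe⟩ := hh3 _ (hi ⟨x, hx, rfl⟩)
      refine ⟨y, sg t, ht0.trans (hsgge t), ?_, ?_⟩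
      · by_cases hd : (T + t1)/2 ≤ t
        · rw [hsghi t hd]; exact ht1
        · have : sg t < sg ((T + t1)/2) := sg.lt_iff_lt.2 (not_le.1 hd)
          rw [hsghi _ le_rfl] at this
          linarith
      · simp only [Homeomorph.trans_apply, ← hs1, Homeomorph.symm_apply_apply, ← hxe]
        simp
  set θ : ℝ → ℝ := fun u => t1 - (t1 - t0) / (1 + u) with hθ
  set ρ : ℝ → ℝ := fun t => max 0 ((t1 - t0) / (t1 - t) - 1) with hρ
  have h01 : 0 < t1 - t0 := by linarith
  have θlt : ∀ u, 0 ≤ u → θ u < t1 := by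
    intro u hu
    have : 0 < (t1 - t0) / (1 + u) := by positivity
    simp only [hθ]; linarith
  have θmono : ∀ u w, 0 ≤ u → u < w → θ u < θ w := by
    intro u w hu huw
    have : (t1 - t0) / (1 + w) < (t1 - t0) / (1 + u) := by gcongr
    simp only [hθ]; linarith
  have θmono' : ∀ u w, 0 ≤ u → u ≤ w → θ u ≤ θ w := by
    intro u w hu huw
    rcases huw.eq_or_lt with rfl | h
    · exact le_rfl
    · exact (θmono u w hu h).le
  have θ0 : θ 0 = t0 := by simp [hθ]
  have θρ : ∀ t, t0 ≤ t → t < t1 → θ (ρ t) = t := by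
    intro t h1 h2
    have h3 : 0 < t1 - t := by linarith
    have : ρ t = (t1 - t0) / (t1 - t) - 1 := by
      apply max_eq_right
      rw [sub_nonneg, one_le_div h3]; linarith
    simp only [hθ, this]
    rw [add_sub_cancel, div_div_cancel₀ h01.ne']
    ring
  have ρθ : ∀ u, 0 ≤ u → ρ (θ u) = u := by
    intro u hu
    have : (t1 - t0) / (t1 - θ u) - 1 = u := by
      simp only [hθ]
      have : 0 < 1 + u := by linarith
      rw [sub_sub_cancel, div_div_cancel₀ h01.ne']
      ring
    simp only [hρ, this, max_eq_right hu]
  have ρ0 : ∀ t, 0 ≤ ρ t := fun t => le_max_left _ _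
  -- the sequence
  let St := {x : (M ≃ₜ M) × ℝ // x.1 '' U = U ∧ x.2 < t1}
  have step : ∀ (k : ℕ) (x : St), ∃ x' : St, x.1.2 ≤ x'.1.2 ∧ θ (k + 1) ≤ x'.1.2 ∧
      (∀ y t, t ≤ x.1.2 → x'.1.1 (β (y, t)) = x.1.1 (β (y, t))) ∧
      (∀ z ∈ Q k, ∃ y t, t0 ≤ t ∧ t ≤ x'.1.2 ∧ z = x'.1.1 (β (y, t))) := by
    rintro k ⟨⟨h, T⟩, hU, hT⟩
    have hU : h '' U = U := hU
    have hT : T < t1 := hT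
    have hUs : h.symm '' U = U := by
      conv_lhs => rw [← hU]
      rw [← image_comp]; simp
    obtain ⟨h2, a1, a2, a3⟩ := hE' T hT (h.symm '' Q k) (by rw [← hUs]; exact image_mono (hQU k))
      ((hQc k).image h.symm.continuous)
    have hLc : IsCompact ((h2.trans h).symm '' Q k) := (hQc k).image (h2.trans h).symm.continuous
    have hLsub : ∀ x ∈ (h2.trans h).symm '' Q k, ∃ y t, t0 ≤ t ∧ t < t1 ∧ x = β (y, t) := by
      rintro _ ⟨z, hz, rfl⟩
      obtain ⟨y, t, b1, b2, b3⟩ := a3 _ ⟨z, hz, rfl⟩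
      refine ⟨y, t, b1, b2, ?_⟩
      rw [Homeomorph.symm_apply_eq, Homeomorph.trans_apply, ← b3]; simp
    have hpre : IsCompact (β ⁻¹' ((h2.trans h).symm '' Q k)) := by
      refine hβ.isInducing.isCompact_preimage' hLc ?_
      intro x hx
      obtain ⟨y, t, -, -, rfl⟩ := hLsub x hx
      exact ⟨_, rfl⟩
    obtain ⟨T2, hT2, hT2b⟩ := compact_bound _ (hpre.image continuous_snd) t1 (by
      rintro _ ⟨⟨y, t⟩, hz, rfl⟩
      obtain ⟨y', t', -, c2, c3⟩ := hLsub _ hz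
      have := hβ.injective c3
      simp only [Prod.mk.injEq] at this
      simp only [this.2, c2])
    refine ⟨⟨⟨h2.trans h, max T (max T2 (θ (k+1)))⟩, ?_, ?_⟩, ?_, ?_, ?_, ?_⟩
    · have : ⇑(h2.trans h) = h ∘ h2 := rfl
      change ⇑(h2.trans h) '' U = U
      rw [this, image_comp, a1, hU]
    · exact max_lt hT (max_lt hT2 (θlt _ (by positivity)))
    · exact le_max_left _ _
    · exact (le_max_right _ _).trans (le_max_right _ _)
    · intro y t ht
      simp only [Homeomorph.trans_apply, a2 y t ht]
    · intro z hz
      obtain ⟨y, t, b1, b2, b3⟩ := hLsub _ ⟨z, hz, rfl⟩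
      refine ⟨y, t, b1, ?_, ?_⟩
      · refine le_trans (hT2b t ⟨(y, t), ?_, rfl⟩) ((le_max_left _ _).trans (le_max_right _ _))
        rw [mem_preimage, ← b3]; exact ⟨z, hz, rfl⟩
      · rw [← b3]; simp
  choose nxt n1 n2 n3 n4 using step
  let sq : ℕ → St := fun k => Nat.rec ⟨⟨Homeomorph.refl M, t0⟩, by simp, by linarith⟩ (fun k x => nxt k x) k
  have sq_succ : ∀ k, sq (k+1) = nxt k (sq k) := fun k => rfl
  set H : ℕ → (M ≃ₜ M) := fun k => (sq k).1.1 with hH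
  set T : ℕ → ℝ := fun k => (sq k).1.2 with hT
  have HU : ∀ k, H k '' U = U := fun k => (sq k).2.1
  have Tlt : ∀ k, T k < t1 := fun k => (sq k).2.2
  have Tmono : Monotone T := monotone_nat_of_le_succ (fun k => by
    simp only [hT, sq_succ]; exact n1 k (sq k))
  have Tθ : ∀ k : ℕ, θ k ≤ T k := by
    intro k
    cases k with
    | zero => simp only [Nat.cast_zero, θ0]; exact le_rfl
    | succ k => simp only [hT, sq_succ]; push_cast; exact n2 k (sq k)
  have agree : ∀ k j, k ≤ j → ∀ y t, t ≤ T k → H j (β (y, t)) = H k (β (y, t)) := by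
    intro k j hkj
    induction j, hkj using Nat.le_induction with
    | base => intros; rfl
    | succ j hj ih =>
      intro y t ht
      rw [← ih y t ht]
      simp only [hH, sq_succ]
      exact n3 j (sq j) y t (ht.trans (Tmono hj))
  have cover : ∀ k, ∀ z ∈ Q k, ∃ y t, t0 ≤ t ∧ t ≤ T (k+1) ∧ z = H (k+1) (β (y, t)) := by
    intro k z hz
    obtain h := n4 k (sq k) z hz
    simpa only [hT, hH, sq_succ] using h
  have HUmem : ∀ k x, H k x ∈ U ↔ x ∈ U := by
    intro k x
    conv_lhs => rw [← HU k]
    exact (H k).injective.mem_set_image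
  let φ : B × Ici (0:ℝ) → U := fun z => ⟨H (⌈(z.2:ℝ)⌉₊) (β (z.1, θ z.2)), by
    rw [HUmem]; exact hU1 _ _ (by rw [← θ0]; exact θmono' _ _ le_rfl z.2.2) (θlt _ z.2.2)⟩
  have φeq : ∀ (z : B × Ici (0:ℝ)) (k : ℕ), (z.2:ℝ) ≤ k → (φ z : M) = H k (β (z.1, θ z.2)) := by
    intro z k hk
    have h1 : ⌈(z.2:ℝ)⌉₊ ≤ k := Nat.ceil_le.2 hk
    exact (agree _ _ h1 z.1 _ ((θmono' _ _ z.2.2 (Nat.le_ceil _)).trans (Tθ _))).symm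
  have φinj : Function.Injective φ := by
    intro z w hzw
    obtain ⟨k, hk⟩ := exists_nat_ge (max (z.2:ℝ) (w.2:ℝ))
    have e1 := φeq z k ((le_max_left _ _).trans hk)
    have e2 := φeq w k ((le_max_right _ _).trans hk)
    rw [hzw, e2] at e1
    have e3 := hβ.injective ((H k).injective e1)
    simp only [Prod.mk.injEq] at e3
    refine Prod.ext e3.1.symm (Subtype.ext ?_)
    rw [← ρθ _ z.2.2, ← ρθ _ w.2.2, e3.2]
  have φsurj : Function.Surjective φ := by
    rintro ⟨x, hx⟩
    obtain ⟨k, hk⟩ := hex {x} (by simpa using hx) isCompact_singleton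
    obtain ⟨y, t, ht0, htT, hxe⟩ := cover k x (hk rfl)
    have ht1 : t < t1 := htT.trans_lt (Tlt (k+1))
    refine ⟨(y, ⟨ρ t, ρ0 t⟩), Subtype.ext ?_⟩
    obtain ⟨j, hj⟩ := exists_nat_ge (ρ t)
    rw [φeq _ (max j (k+1)) (hj.trans (by exact_mod_cast le_max_left _ _))]
    simp only [θρ t ht0 ht1, hxe]
    exact agree _ _ (le_max_right _ _) y t htT
  have φcont : Continuous φ := by
    rw [continuous_iff_continuousAt]
    intro z
    obtain ⟨k, hk⟩ := exists_nat_gt (z.2:ℝ)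
    rw [IsInducing.subtypeVal.continuousAt_iff]
    have hz : 1 + (z.2:ℝ) ≠ 0 := by
      have := z.2.2
      have h' : (0:ℝ) ≤ z.2 := this
      linarith
    have hev : ∀ᶠ w : B × Ici (0:ℝ) in 𝓝 z, (w.2:ℝ) < k :=
      (continuous_subtype_val.comp continuous_snd).continuousAt.eventually_lt continuousAt_const hk
    have hc2 : ContinuousAt (fun w : B × Ici (0:ℝ) => (w.2:ℝ)) z :=
      (continuous_subtype_val.comp continuous_snd).continuousAt
    have hcθ : ContinuousAt (fun w : B × Ici (0:ℝ) => θ w.2) z := by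
      simp only [hθ]
      exact continuousAt_const.sub (continuousAt_const.div (continuousAt_const.add hc2) hz)
    have hmain : ContinuousAt (fun w : B × Ici (0:ℝ) => H k (β (w.1, θ w.2))) z :=
      ((H k).continuous.comp hβ.continuous).continuousAt.comp (continuousAt_fst.prodMk hcθ)
    refine hmain.congr ?_
    filter_upwards [hev] with w hw
    exact (φeq w k hw.le).symm
  have φopen : IsOpenMap φ := by
    intro W hW
    rw [isOpen_iff_mem_nhds]
    rintro _ ⟨z, hz, rfl⟩
    obtain ⟨k, hk⟩ := exists_nat_gt (z.2:ℝ)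
    set Z : Set (B × ℝ) := {w | w.2 < θ k} ∩ (fun w : B × ℝ => ((w.1, ⟨ρ w.2, ρ0 w.2⟩) : B × Ici (0:ℝ))) ⁻¹' W with hZ
    have hZo : IsOpen Z := by
      refine ContinuousOn.isOpen_inter_preimage ?_ (isOpen_lt continuous_snd continuous_const) hW
      refine continuousOn_fst.prodMk ?_
      rw [IsInducing.subtypeVal.continuousOn_iff]
      refine ContinuousOn.sup continuousOn_const ?_
      refine ContinuousOn.sub (continuousOn_const.div (continuousOn_const.sub continuousOn_snd) ?_) continuousOn_const
      intro w hw
      have : w.2 < t1 := lt_trans hw (θlt _ (by positivity))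
      linarith
    have hopen : IsOpen (Subtype.val ⁻¹' (H k '' (β '' Z)) : Set U) :=
      ((H k).isOpenMap _ (hβ.isOpenMap _ hZo)).preimage continuous_subtype_val
    refine Filter.mem_of_superset (hopen.mem_nhds ?_) ?_
    · refine ⟨_, ⟨(z.1, θ z.2), ⟨θmono _ _ z.2.2 hk, ?_⟩, rfl⟩, (φeq z k hk.le).symm⟩
      simp only [mem_preimage]
      convert hz using 2
      exact Subtype.ext (ρθ _ z.2.2)
    · rintro ⟨x, hx⟩ ⟨_, ⟨w, ⟨hw1, hw2⟩, rfl⟩, hxw⟩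
      simp only at hxw
      have hwt1 : w.2 < t1 := lt_trans hw1 (θlt _ (by positivity))
      have hw0 : t0 ≤ w.2 := by
        by_contra hlt
        refine hU2 w.1 w.2 (not_le.1 hlt) ?_
        rw [← hxw, HUmem] at hx; exact hx
      refine ⟨_, hw2, Subtype.ext ?_⟩
      have hρk : ρ w.2 ≤ k := by
        by_contra hlt
        have := θmono _ _ (by positivity) (not_le.1 hlt)
        rw [θρ _ hw0 hwt1] at this
        exact lt_asymm this hw1
      rw [φeq _ k hρk]
      simp only [θρ _ hw0 hwt1]
      exact hxw
  exact ⟨((Equiv.ofBijective φ ⟨φinj, φsurj⟩).toHomeomorphOfContinuousOpen φcont φopen).symm⟩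

end eng

section eng2
variable {M : Type*} [TopologicalSpace M] [T2Space M] {B : Type*} [TopologicalSpace B]
  [CompactSpace B]

lemma engulf (β : B × ℝ → M) (U : Set M) (t0 τ t1 : ℝ)
    (Q : ℕ → Set M) (e : ℕ → B × ℝ → M) (he : ∀ i, IsOpenEmbedding (e i)) (a p q d : ℝ)
    (hap : a < p) (hpq : p ≤ q) (hqd : q < d)
    (hsup : ∀ i y t, a ≤ t → t ≤ d → e i (y, t) ∈ U ∧ ∀ y' t', t' ≤ τ → β (y', t') ≠ e i (y, t))
    (hQ0 : ∀ x ∈ Q 0, ∃ y t, t0 ≤ t ∧ t < t1 ∧ x = β (y, t))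
    (hQ1 : ∀ i y t, a ≤ t → t ≤ p → e i (y, t) ∈ Q i)
    (hQ2 : ∀ i y t, e i (y, t) ∈ Q i → t ≤ d → t ≤ p)
    (hQs : ∀ i x, x ∈ Q (i+1) → x ∈ Q i ∨ ∃ y t, a ≤ t ∧ t ≤ q ∧ x = e i (y, t)) :
    ∀ i, ∃ h : M ≃ₜ M, h '' U = U ∧ (∀ y t, t ≤ τ → h (β (y, t)) = β (y, t)) ∧
      ∀ x ∈ Q i, ∃ y t, t0 ≤ t ∧ t < t1 ∧ x = h (β (y, t)) := by
  intro i
  induction i with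
  | zero => exact ⟨Homeomorph.refl M, by simp, fun _ _ _ => rfl, hQ0⟩
  | succ i ih =>
    obtain ⟨h, h1, h2, h3⟩ := ih
    obtain ⟨sg, hsgp, hsglo, hsghi, hsgge⟩ := exists_stretch a p q d hap hpq hqd
    obtain ⟨s, hs1, hs2⟩ := stretch_homeo (e i) (he i) a d sg hsglo hsghi
    have hsU : s '' U = U := by
      refine image_eq_of_fix s U _ ?_ hs2
      rintro _ ⟨⟨y, t⟩, ⟨-, ht⟩, rfl⟩
      exact (hsup i y t ht.1 ht.2).1
    have hsymm : ∀ y t, s.symm (e i (y, t)) = e i (y, sg.symm t) := by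
      intro y t
      rw [Homeomorph.symm_apply_eq, hs1]; simp
    have key : ∀ y t, a ≤ t → t ≤ q → s.symm (e i (y, t)) ∈ Q i := by
      intro y t ha hq
      rw [hsymm]
      apply hQ1
      · rw [← sg.le_iff_le, OrderIso.apply_symm_apply, hsglo a le_rfl]; exact ha
      · rw [← sg.le_iff_le, OrderIso.apply_symm_apply, hsgp]; exact hq
    refine ⟨h.trans s, ?_, ?_, ?_⟩
    · have : ⇑(h.trans s) = s ∘ h := rfl
      rw [this, image_comp, h1, hsU]
    · intro y t ht
      rw [Homeomorph.trans_apply, h2 y t ht]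
      apply hs2
      rintro ⟨⟨y', t'⟩, ⟨-, ht'⟩, he'⟩
      exact (hsup i y' t' ht'.1 ht'.2).2 y t ht he'.symm
    · intro x hx
      have hx' : s.symm x ∈ Q i := by
        rcases hQs i x hx with hxi | ⟨y, t, ha, hq, rfl⟩
        · by_cases hxe : x ∈ e i '' (univ ×ˢ Icc a d)
          · obtain ⟨⟨y, t⟩, ⟨-, ht⟩, rfl⟩ := hxe
            exact key y t ht.1 ((hQ2 i y t hxi ht.2).trans hpq)
          · have : s.symm x = x := by
              rw [Homeomorph.symm_apply_eq]; exact (hs2 x hxe).symm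
            rw [this]; exact hxi
        · exact key y t ha hq
      obtain ⟨y, t, a1, a2, a3⟩ := h3 _ hx'
      refine ⟨y, t, a1, a2, ?_⟩
      rw [Homeomorph.trans_apply, ← a3]; simp

lemma collar_engulf (β : B × ℝ → M) (hβ : IsOpenEmbedding β) (U : Set M) (t0 τ t1 : ℝ)
    (h0τ : t0 < τ) (hτ1 : τ < t1)
    (hU1 : ∀ y t, t0 ≤ t → t < t1 → β (y, t) ∈ U) (hU2 : ∀ y t, t < t0 → β (y, t) ∉ U)
    (Q : ℕ → Set M) (hQc : ∀ i, IsCompact (Q i)) (hQU : ∀ i, Q i ⊆ U)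
    (hex : ∀ L ⊆ U, IsCompact L → ∃ i, L ⊆ Q i)
    (e : ℕ → B × ℝ → M) (he : ∀ i, IsOpenEmbedding (e i)) (a p q d : ℝ)
    (hap : a < p) (hpq : p ≤ q) (hqd : q < d)
    (hsup : ∀ i y t, a ≤ t → t ≤ d → e i (y, t) ∈ U ∧ ∀ y' t', t' ≤ τ → β (y', t') ≠ e i (y, t))
    (hQ0 : ∀ x ∈ Q 0, ∃ y t, t0 ≤ t ∧ t < t1 ∧ x = β (y, t))
    (hQ1 : ∀ i y t, a ≤ t → t ≤ p → e i (y, t) ∈ Q i)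
    (hQ2 : ∀ i y t, e i (y, t) ∈ Q i → t ≤ d → t ≤ p)
    (hQs : ∀ i x, x ∈ Q (i+1) → x ∈ Q i ∨ ∃ y t, a ≤ t ∧ t ≤ q ∧ x = e i (y, t)) :
    Nonempty (U ≃ₜ B × Ici (0:ℝ)) :=
  collar_union β hβ U t0 τ t1 h0τ hτ1 hU1 hU2 Q hQc hQU hex
    (engulf β U t0 τ t1 Q e he a p q d hap hpq hqd hsup hQ0 hQ1 hQ2 hQs)
end eng2

section idm
variable {M : Type*} [TopologicalSpace M]

lemma inv_dom_mfld (hM : LocallyEuclidean 3 M) (O : Set E3) (hO : IsOpen O) (ψ : E3 → M)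
    (hc : ContinuousOn ψ O) (hi : InjOn ψ O) : IsOpen (ψ '' O) := by
  classical
  rw [isOpen_iff_mem_nhds]
  rintro _ ⟨v, hv, rfl⟩
  obtain ⟨V, hV, hvV, U, hU, ⟨χ⟩⟩ := hM (ψ v)
  set O' := O ∩ ψ ⁻¹' V with hO'
  have hO'o : IsOpen O' := hc.isOpen_inter_preimage hO hV
  set g : E3 → E3 := fun w => if h : ψ w ∈ V then (χ ⟨ψ w, h⟩ : E3) else 0 with hg
  have gV : ∀ w (h : ψ w ∈ V), g w = χ ⟨ψ w, h⟩ := fun w h => by simp only [hg, dif_pos h]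
  have gc : ContinuousOn g O' := by
    rw [continuousOn_iff_continuous_domRestrict]
    have : O'.domRestrict g = fun w : O' => (χ ⟨ψ w, w.2.2⟩ : E3) := by
      funext w; exact gV w w.2.2
    rw [this]
    refine continuous_subtype_val.comp (χ.continuous.comp ?_)
    refine Continuous.subtype_mk ?_ _
    exact continuousOn_iff_continuous_domRestrict.1 (hc.mono inter_subset_left)
  have gi : InjOn g O' := by
    intro w hw w' hw' h
    rw [gV w hw.2, gV w' hw'.2] at h
    have := χ.injective (Subtype.ext h)
    exact hi hw.1 hw'.1 (congrArg Subtype.val this)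
  have go := invariance_of_domain g O' hO'o gc gi
  have h2 : IsOpen (Subtype.val '' ((fun x : V => (χ x : E3)) ⁻¹' (g '' O')) : Set M) :=
    hV.isOpenMap_subtype_val _ (go.preimage (continuous_subtype_val.comp χ.continuous))
  refine Filter.mem_of_superset (h2.mem_nhds ⟨⟨ψ v, hvV⟩, ⟨v, ⟨hv, hvV⟩, gV v hvV⟩, rfl⟩) ?_
  rintro _ ⟨x, ⟨w, hw, hwx⟩, rfl⟩
  refine ⟨w, hw.1, ?_⟩
  rw [gV w hw.2] at hwx
  have := χ.injective (Subtype.ext hwx)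
  exact congrArg Subtype.val this

lemma collar_open (hM : LocallyEuclidean 3 M) {K : Type*} [TopologicalSpace K]
    (hsurf : ∀ x : K, ∃ V : Set K, IsOpen V ∧ x ∈ V ∧
      Nonempty (↥V ≃ₜ EuclideanSpace ℝ (Fin 2)))
    (c : K × ℝ → M) (hc : Continuous c) (hi : InjOn c (univ ×ˢ Ioo (-1:ℝ) 1))
    (W : Set (K × ℝ)) (hW : IsOpen W) (hWs : W ⊆ univ ×ˢ Ioo (-1:ℝ) 1) : IsOpen (c '' W) := by
  rw [isOpen_iff_mem_nhds]
  rintro _ ⟨⟨x, t⟩, hxt, rfl⟩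
  obtain ⟨V, hV, hxV, ⟨φ⟩⟩ := hsurf x
  set j : E3 → K × ℝ := fun v => ((φ.symm (WithLp.toLp 2 ![v 0, v 1]) : V), v 2) with hj
  have jc : Continuous j := by
    refine Continuous.prodMk (continuous_subtype_val.comp (φ.symm.continuous.comp ?_)) (by fun_prop)
    refine (PiLp.continuous_toLp 2 _).comp ?_
    refine continuous_pi (fun i => ?_)
    fin_cases i <;> simp <;> fun_prop
  have ji : Function.Injective j := by
    intro v w h
    simp only [hj, Prod.mk.injEq] at h
    have h1 := φ.symm.injective (Subtype.ext h.1)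
    have h0 := congrArg (fun u : EuclideanSpace ℝ (Fin 2) => u 0) h1
    have h1' := congrArg (fun u : EuclideanSpace ℝ (Fin 2) => u 1) h1
    simp at h0 h1'
    ext i
    fin_cases i
    · exact h0
    · exact h1'
    · exact h.2
  have key := inv_dom_mfld hM (j ⁻¹' W) (hW.preimage jc) (c ∘ j) (hc.comp jc).continuousOn (by
    intro v hv w hw h
    exact ji (hi (hWs hv) (hWs hw) h))
  set u := φ ⟨x, hxV⟩
  have hpt : j (WithLp.toLp 2 ![u 0, u 1, t]) = (x, t) := by
    simp only [hj]
    have : (WithLp.toLp 2 ![u 0, u 1] : EuclideanSpace ℝ (Fin 2)) = u := by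
      ext i; fin_cases i <;> simp
    refine Prod.ext ?_ (by simp)
    simp only
    have e2 : φ.symm (WithLp.toLp 2 ![u 0, u 1]) = ⟨x, hxV⟩ := by
      rw [this]; simp [u]
    simpa using congrArg Subtype.val e2
  refine Filter.mem_of_superset (key.mem_nhds ⟨_, ?_, congrArg c hpt⟩) ?_
  · rw [mem_preimage, hpt]; exact hxt
  · rintro _ ⟨v, hv, rfl⟩; exact ⟨_, hv, rfl⟩

lemma exists_beta (hM : LocallyEuclidean 3 M) (K : Set M) (hKc : IsCompact K)
    (hsurf : ∀ x : ↥K, ∃ V : Set ↥K, IsOpen V ∧ x ∈ V ∧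
      Nonempty (↥V ≃ₜ EuclideanSpace ℝ (Fin 2)))
    (hbicol : Bicollared K) :
    ∃ β : (↥K × Fin 2) × ℝ → M, IsOpenEmbedding β ∧ (∀ z, β z ∉ K) ∧
      (∀ t, IsCompact (K ∪ β '' (univ ×ˢ Iic t))) ∧ (∀ t, IsOpen (K ∪ β '' (univ ×ˢ Iio t))) ∧
      ∀ V ∈ 𝓝ˢ K, ∃ t, K ∪ β '' (univ ×ˢ Iic t) ⊆ V := by
  obtain ⟨b, hb, hb0⟩ := hbicol
  have : CompactSpace K := isCompact_iff_compactSpace.1 hKc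
  set c : K × ℝ → M := fun z => b (z.1, projIcc (-1:ℝ) 1 (by norm_num) z.2) with hcdef
  have hc : Continuous c :=
    hb.continuous.comp (continuous_fst.prodMk (continuous_projIcc.comp continuous_snd))
  have hci : InjOn c (univ ×ˢ Ioo (-1:ℝ) 1) := by
    rintro ⟨x, s⟩ ⟨-, hs⟩ ⟨y, u⟩ ⟨-, hu⟩ h
    have h' := hb.injective h
    simp only [Prod.mk.injEq] at h'
    have hs' : s ∈ Icc (-1:ℝ) 1 := Ioo_subset_Icc_self hs
    have hu' : u ∈ Icc (-1:ℝ) 1 := Ioo_subset_Icc_self hu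
    rw [projIcc_of_mem _ hs', projIcc_of_mem _ hu'] at h'
    exact Prod.ext h'.1 (congrArg Subtype.val h'.2)
  have hc0 : ∀ x : K, c (x, 0) = x := by
    intro x
    rw [← hb0 x]
    simp only [hcdef]
    rw [projIcc_of_mem _ (by norm_num : (0:ℝ) ∈ Icc (-1:ℝ) 1)]
  have hopen := collar_open hM hsurf c hc hci
  set r := Real.sigmoid
  have hr0 : ∀ t, 0 < r t := Real.sigmoid_pos
  have hr1 : ∀ t, r t < 1 := Real.sigmoid_lt_one
  have hrm : StrictMono r := Real.sigmoid_strictMono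
  have hrs : ∀ l, 0 < l → l < 1 → ∃ t, r t = l := by
    intro l h0 h1
    have : l ∈ range r := by rw [Real.range_sigmoid]; exact ⟨h0, h1⟩
    exact this
  have hro : IsOpenEmbedding r := ⟨hrm.isEmbedding_of_ordConnected (by rw [Real.range_sigmoid]; exact ordConnected_Ioo), by
    rw [Real.range_sigmoid]; exact isOpen_Ioo⟩
  set sn : Fin 2 → ℝ := ![1, -1] with hsn
  have hsn' : ∀ i, sn i = 1 ∨ sn i = -1 := by intro i; fin_cases i <;> simp [hsn]
  set k : (↥K × Fin 2) × ℝ → K × ℝ := fun z => (z.1.1, sn z.1.2 * r z.2) with hk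
  have hkIoo : ∀ z, k z ∈ (univ ×ˢ Ioo (-1:ℝ) 1 : Set (K × ℝ)) := by
    intro z
    refine ⟨mem_univ _, ?_⟩
    have := hr0 z.2
    have := hr1 z.2
    simp only [hk]
    rcases hsn' z.1.2 with h | h <;> rw [h] <;> constructor <;> linarith
  have hki : Function.Injective k := by
    rintro ⟨⟨x, i⟩, t⟩ ⟨⟨y, j⟩, u⟩ h
    simp only [hk, Prod.mk.injEq] at h
    obtain ⟨rfl, h⟩ := h
    have := hr0 t
    have := hr0 u
    fin_cases i <;> fin_cases j <;> simp [hsn] at h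
    · simp [hrm.injective h]
    · linarith
    · linarith
    · simp [hrm.injective h]
  have hko : IsOpenMap k := by
    intro W hW
    have : k '' W = ⋃ i : Fin 2, (Prod.map id (fun t => sn i * r t)) '' {z : K × ℝ | ((z.1, i), z.2) ∈ W} := by
      ext z
      simp only [mem_image, mem_iUnion, mem_ofPred_eq]
      constructor
      · rintro ⟨⟨⟨x, i⟩, t⟩, hw, rfl⟩
        exact ⟨i, (x, t), hw, rfl⟩
      · rintro ⟨i, ⟨x, t⟩, hw, rfl⟩
        exact ⟨_, hw, rfl⟩
    rw [this]
    refine isOpen_iUnion (fun i => ?_)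
    refine IsOpenMap.prodMap IsOpenMap.id ?_ _ (hW.preimage (by fun_prop))
    have hne : sn i ≠ 0 := by rcases hsn' i with h | h <;> rw [h] <;> norm_num
    exact (Homeomorph.mulLeft₀ (sn i) hne).isOpenMap.comp hro.isOpenMap
  have hkc : Continuous k := by
    refine Continuous.prodMk (by fun_prop) ?_
    have h1 : Continuous sn := continuous_of_discreteTopology
    exact (h1.comp (by fun_prop)).mul (hro.continuous.comp continuous_snd)
  have hset : ∀ S : Set ℝ, K ∪ (c ∘ k) '' (univ ×ˢ S) = c '' (univ ×ˢ {s | s = 0 ∨ |s| ∈ r '' S}) := by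
    intro S
    ext x
    constructor
    · rintro (hx | ⟨⟨⟨y, i⟩, t⟩, ⟨-, ht⟩, rfl⟩)
      · exact ⟨(⟨x, hx⟩, 0), ⟨mem_univ _, Or.inl rfl⟩, hc0 _⟩
      · refine ⟨_, ⟨mem_univ _, Or.inr ⟨t, ht, ?_⟩⟩, rfl⟩
        simp only [hk, abs_mul, abs_of_pos (hr0 t)]
        rcases hsn' i with h | h <;> simp [h]
    · rintro ⟨⟨y, s⟩, ⟨-, hs | ⟨t, ht, hts⟩⟩, rfl⟩
      · left; simp only at hs; rw [hs, hc0]; exact y.2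
      · right
        simp only at hts
        rcases abs_choice s with h | h
        · refine ⟨((y, 0), t), ⟨mem_univ _, ht⟩, ?_⟩
          simp [hk, hsn, hts, h]
        · refine ⟨((y, 1), t), ⟨mem_univ _, ht⟩, ?_⟩
          simp [hk, hsn, hts, h]
  have hN : ∀ t, K ∪ (c ∘ k) '' (univ ×ˢ Iic t) = c '' (univ ×ˢ Icc (-(r t)) (r t)) := by
    intro t
    rw [hset]
    congr 2
    ext s
    simp only [mem_ofPred_eq, ← abs_le, mem_Icc]
    constructor
    · rintro (rfl | ⟨u, hu, hus⟩)
      · simpa using (hr0 t).le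
      · rw [← hus]; exact hrm.monotone hu
    · intro h
      by_cases h0 : s = 0
      · exact Or.inl h0
      · obtain ⟨u, hu⟩ := hrs |s| (abs_pos.2 h0) (h.trans_lt (hr1 t))
        exact Or.inr ⟨u, hrm.le_iff_le.1 (by rw [hu]; exact h), hu⟩
  have hO : ∀ t, K ∪ (c ∘ k) '' (univ ×ˢ Iio t) = c '' (univ ×ˢ Ioo (-(r t)) (r t)) := by
    intro t
    rw [hset]
    congr 2
    ext s
    simp only [mem_ofPred_eq, ← abs_lt, mem_Ioo]
    constructor
    · rintro (rfl | ⟨u, hu, hus⟩)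
      · simpa using (hr0 t)
      · rw [← hus]; exact hrm hu
    · intro h
      by_cases h0 : s = 0
      · exact Or.inl h0
      · obtain ⟨u, hu⟩ := hrs |s| (abs_pos.2 h0) (h.trans (hr1 t))
        exact Or.inr ⟨u, hrm.lt_iff_lt.1 (by rw [hu]; exact h), hu⟩
  refine ⟨c ∘ k, ?_, ?_, ?_, ?_, ?_⟩
  · refine IsOpenEmbedding.of_continuous_injective_isOpenMap (hc.comp hkc) ?_ ?_
    · intro z w h
      exact hki (hci (hkIoo z) (hkIoo w) h)
    · intro W hW
      rw [image_comp]
      exact hopen _ (hko W hW) (by rintro _ ⟨z, -, rfl⟩; exact hkIoo z)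
  · intro z hz
    have h1 : c (k z) = c (⟨_, hz⟩, 0) := (hc0 ⟨_, hz⟩).symm
    have h2 := hci (hkIoo z) (show ((⟨_, hz⟩, 0) : K × ℝ) ∈ _ from ⟨mem_univ _, by norm_num⟩) h1
    have h3 := congrArg Prod.snd h2
    simp only [hk] at h3
    have := hr0 z.2
    rcases hsn' z.1.2 with h | h <;> rw [h] at h3 <;> linarith
  · intro t
    rw [hN]
    exact (isCompact_univ.prod isCompact_Icc).image hc
  · intro t
    rw [hO]
    refine hopen _ (isOpen_univ.prod isOpen_Ioo) ?_
    refine prod_mono le_rfl (Ioo_subset_Ioo ?_ (hr1 t).le)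
    have := hr1 t; linarith
  · intro V hV
    have hVo : IsOpen (c ⁻¹' (interior V)) := isOpen_interior.preimage hc
    have hK : K ⊆ interior V := subset_interior_iff_mem_nhdsSet.2 hV
    obtain ⟨u, v, hu, hv, huu, hvv, huv⟩ := generalized_tube_lemma (isCompact_univ (X := K))
      (isCompact_singleton (x := (0:ℝ))) hVo (by
        rintro ⟨x, s⟩ ⟨-, hs⟩
        rw [mem_singleton_iff] at hs
        simp only at hs
        rw [mem_preimage, hs, hc0]; exact hK x.2)
    obtain ⟨e, he, hball⟩ := Metric.isOpen_iff.1 hv 0 (hvv rfl)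
    obtain ⟨t, ht⟩ := hrs (min e 1 / 2) (by positivity) (by
      have := min_le_right e 1; linarith)
    refine ⟨t, ?_⟩
    rw [hN]
    rintro _ ⟨⟨x, s⟩, ⟨-, hs⟩, rfl⟩
    refine interior_subset (huv ⟨huu (mem_univ _), hball ?_⟩)
    rw [Metric.mem_ball, Real.dist_eq, sub_zero]
    have := abs_le.2 hs
    rw [ht] at this
    have := min_le_left e 1
    have : 0 < min e 1 := by positivity
    linarith
end idm

section bdry
variable {M : Type*} [TopologicalSpace M]

lemma homeoToOpen_of_emb {A E : Type*} [TopologicalSpace A] [TopologicalSpace E] (g : A → E)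
    (hg : IsOpenEmbedding g) : HomeoToOpen A E :=
  ⟨range g, hg.isOpen_range, ⟨hg.isEmbedding.toHomeomorph⟩⟩

lemma chart_of_interior (hM : LocallyEuclidean 3 M) (C : Set M) (x : C) (hx : (x:M) ∈ interior C) :
    ∃ W : Set C, IsOpen W ∧ x ∈ W ∧ HomeoToOpen W E3 := by
  obtain ⟨V, hV, hxV, U, hU, ⟨χ⟩⟩ := hM x
  set W : Set C := Subtype.val ⁻¹' (V ∩ interior C) with hW
  have hWo : IsOpen W := (hV.inter isOpen_interior).preimage continuous_subtype_val
  refine ⟨W, hWo, ⟨hxV, hx⟩, ?_⟩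
  have h1 : IsOpenEmbedding (fun w : W => ((w : C) : M)) := by
    refine ⟨IsEmbedding.subtypeVal.comp IsEmbedding.subtypeVal, ?_⟩
    have : range (fun w : W => ((w : C) : M)) = V ∩ interior C := by
      ext y
      constructor
      · rintro ⟨w, rfl⟩; exact w.2
      · intro hy; exact ⟨⟨⟨y, interior_subset hy.2⟩, hy⟩, rfl⟩
    rw [this]
    exact hV.inter isOpen_interior
  let inc : W → V := fun w => ⟨((w : C) : M), w.2.1⟩
  have h2 : IsOpenEmbedding inc :=
    IsOpenEmbedding.of_comp inc hV.isOpenEmbedding_subtypeVal h1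
  exact homeoToOpen_of_emb _ (hU.isOpenEmbedding_subtypeVal.comp (χ.isOpenEmbedding.comp h2))

lemma nhds_of_chart (hM : LocallyEuclidean 3 M) (C : Set M) (x : C) 
    (h : ∃ W : Set C, IsOpen W ∧ x ∈ W ∧ HomeoToOpen W E3) : C ∈ 𝓝 (x:M) := by
  classical
  obtain ⟨W, hW, hxW, U, hU, ⟨χ⟩⟩ := h
  set ψ : E3 → M := fun v => if h : v ∈ U then ((χ.symm ⟨v, h⟩ : C) : M) else x with hψ
  have hψe : ∀ v (h : v ∈ U), ψ v = ((χ.symm ⟨v, h⟩ : C) : M) := fun v h => by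
    simp only [hψ, dif_pos h]
  have h1 : IsOpen (ψ '' U) := by
    refine inv_dom_mfld hM U hU ψ ?_ ?_
    · rw [continuousOn_iff_continuous_domRestrict]
      have : U.domRestrict ψ = fun v : U => ((χ.symm v : C) : M) := by
        funext v; exact hψe v v.2
      rw [this]
      exact continuous_subtype_val.comp (continuous_subtype_val.comp χ.symm.continuous)
    · intro v hv w hw h
      rw [hψe v hv, hψe w hw] at h
      have := χ.symm.injective (Subtype.ext (Subtype.ext h))
      exact congrArg Subtype.val this
  refine Filter.mem_of_superset (h1.mem_nhds ⟨χ ⟨x, hxW⟩, (χ ⟨x, hxW⟩).2, ?_⟩) ?_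
  · rw [hψe _ (χ ⟨x, hxW⟩).2]; simp
  · rintro _ ⟨v, hv, rfl⟩
    rw [hψe v hv]
    exact Subtype.coe_prop _

variable {B : Type*} [TopologicalSpace B]

lemma boundary_eq (hM : LocallyEuclidean 3 M) (β : B × ℝ → M) (hβ : IsOpenEmbedding β) (ε δ : ℝ)
    (h : ε < δ) : subsetBoundary 3 (β '' (univ ×ˢ Icc ε δ)) = β '' (univ ×ˢ {ε, δ}) := by
  set C := β '' (univ ×ˢ Icc ε δ) with hC
  ext x
  constructor
  · rintro ⟨x, hx, rfl⟩
    obtain ⟨⟨y, t⟩, ⟨-, ht⟩, hxe⟩ := x.2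
    refine ⟨(y, t), ⟨mem_univ _, ?_⟩, hxe⟩
    by_contra hne
    simp only [mem_insert_iff, mem_singleton_iff, not_or] at hne
    refine hx (chart_of_interior hM C x ?_)
    have ho : IsOpen (β '' (univ ×ˢ Ioo ε δ)) := hβ.isOpenMap _ (isOpen_univ.prod isOpen_Ioo)
    refine interior_maximal (image_mono (prod_mono le_rfl Ioo_subset_Icc_self)) ho ?_
    exact ⟨(y, t), ⟨mem_univ _, lt_of_le_of_ne ht.1 (Ne.symm hne.1), lt_of_le_of_ne ht.2 hne.2⟩, hxe⟩
  · rintro ⟨⟨y, t⟩, ⟨-, ht⟩, rfl⟩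
    have hmem : β (y, t) ∈ C := by
      refine ⟨(y, t), ⟨mem_univ _, ?_⟩, rfl⟩
      rcases ht with ht | ht <;> simp only [mem_singleton_iff] at ht <;> rw [ht]
      · exact ⟨le_rfl, h.le⟩
      · exact ⟨h.le, le_rfl⟩
    refine ⟨⟨β (y, t), hmem⟩, fun hch => ?_, rfl⟩
    have h1 := nhds_of_chart hM C _ hch
    have h2 : (fun s : ℝ => β (y, s)) ⁻¹' C ∈ 𝓝 t :=
      (hβ.continuous.comp (by fun_prop : Continuous (fun s : ℝ => (y, s)))).continuousAt.preimage_mem_nhds h1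
    have h3 : (fun s : ℝ => β (y, s)) ⁻¹' C = Icc ε δ := by
      ext s
      constructor
      · rintro ⟨⟨y', s'⟩, ⟨-, hs'⟩, he⟩
        have := hβ.injective he
        simp only [Prod.mk.injEq] at this
        rw [← this.2]; exact hs'
      · intro hs; exact ⟨(y, s), ⟨mem_univ _, hs⟩, rfl⟩
    rw [h3, Icc_mem_nhds_iff] at h2
    rcases ht with ht | ht <;> simp only [mem_singleton_iff] at ht <;> rw [ht] at h2
    · exact lt_irrefl _ h2.1
    · exact lt_irrefl _ h2.2

variable [CompactSpace B] [T2Space M]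

lemma boundary_homeo (hM : LocallyEuclidean 3 M) (β : B × ℝ → M) (hβ : IsOpenEmbedding β) (ε δ : ℝ)
    (h : ε < δ) : Nonempty (subsetBoundary 3 (β '' (univ ×ˢ Icc ε δ)) ≃ₜ B ⊕ B) := by
  rw [boundary_eq hM β hβ ε δ h]
  let g : B ⊕ B → (β '' (univ ×ˢ {ε, δ}) : Set M) := Sum.elim
    (fun y => ⟨β (y, ε), (y, ε), ⟨mem_univ _, Or.inl rfl⟩, rfl⟩)
    (fun y => ⟨β (y, δ), (y, δ), ⟨mem_univ _, Or.inr rfl⟩, rfl⟩)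
  have hg : Continuous g := by
    refine Continuous.sumElim ?_ ?_
    · exact (hβ.continuous.comp (by fun_prop)).subtype_mk _
    · exact (hβ.continuous.comp (by fun_prop)).subtype_mk _
  have hbij : Function.Bijective g := by
    constructor
    · rintro (y | y) (w | w) he
      all_goals
        have := hβ.injective (congrArg Subtype.val he)
        simp only [Prod.mk.injEq] at this
      · rw [this.1]
      · exact absurd this.2 h.ne
      · exact absurd this.2 h.ne'
      · rw [this.1]
    · rintro ⟨_, ⟨y, t⟩, ⟨-, ht⟩, rfl⟩
      rcases ht with ht | ht
      · simp only at ht; subst ht; exact ⟨Sum.inl y, rfl⟩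
      · simp only [mem_singleton_iff] at ht; subst ht; exact ⟨Sum.inr y, rfl⟩
  exact ⟨(Continuous.homeoOfEquivCompactToT2 (f := Equiv.ofBijective g hbij) hg).symm⟩

lemma shell_homeo (β : B × ℝ → M) (hβ : IsOpenEmbedding β) (ε δ : ℝ)
    (h : ε < δ) : Nonempty ((β '' (univ ×ˢ Icc ε δ) : Set M) ≃ₜ B × Icc (0:ℝ) 1) := by
  have e1 : B × Icc (0:ℝ) 1 ≃ₜ B × Icc ε δ := (Homeomorph.refl B).prodCongr (iccHomeoI ε δ h).symm
  let g : B × Icc ε δ → (β '' (univ ×ˢ Icc ε δ) : Set M) :=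
    fun z => ⟨β (z.1, z.2), (z.1, z.2), ⟨mem_univ _, z.2.2⟩, rfl⟩
  have hg : Continuous g := (hβ.continuous.comp (by fun_prop)).subtype_mk _
  have hbij : Function.Bijective g := by
    constructor
    · rintro ⟨y, t⟩ ⟨w, s⟩ he
      have := hβ.injective (congrArg Subtype.val he)
      simp only [Prod.mk.injEq] at this
      exact Prod.ext this.1 (Subtype.ext this.2)
    · rintro ⟨_, ⟨y, t⟩, ⟨-, ht⟩, rfl⟩
      exact ⟨(y, ⟨t, ht⟩), rfl⟩
  exact ⟨(e1.trans (Continuous.homeoOfEquivCompactToT2 (f := Equiv.ofBijective g hbij) hg)).symm⟩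

omit [CompactSpace B] [T2Space M] in
lemma sum_homeo (S O1 O2 : Set M) (h1 : IsOpen O1) (h2 : IsOpen O2) (hd : Disjoint O1 O2)
    (hS : S ⊆ O1 ∪ O2) : Nonempty (S ≃ₜ (S ∩ O1 : Set M) ⊕ (S ∩ O2 : Set M)) := by
  let g : (S ∩ O1 : Set M) ⊕ (S ∩ O2 : Set M) → S :=
    Sum.elim (inclusion inter_subset_left) (inclusion inter_subset_left)
  have hg : Continuous g := (continuous_inclusion _).sumElim (continuous_inclusion _)
  have aux : ∀ O : Set M, IsOpen O → IsOpenMap (inclusion (inter_subset_left : S ∩ O ⊆ S)) := by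
    intro O hO
    refine (IsOpenEmbedding.mk (IsEmbedding.inclusion _) ?_).isOpenMap
    rw [range_inclusion]
    have : {x : S | (x:M) ∈ S ∩ O} = Subtype.val ⁻¹' O := by
      ext x; simp
    rw [this]; exact hO.preimage continuous_subtype_val
  have ho : IsOpenMap g := IsOpenMap.sumElim (aux O1 h1) (aux O2 h2)
  have hbij : Function.Bijective g := by
    constructor
    · rintro (y | y) (w | w) he
      all_goals have hv : (y:M) = w := congrArg (fun z : S => (z:M)) he
      · rw [Subtype.ext hv]
      · exact absurd w.2.2 (hv ▸ disjoint_left.1 hd y.2.2)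
      · exact absurd y.2.2 (hv ▸ disjoint_left.1 hd w.2.2)
      · rw [Subtype.ext hv]
    · rintro ⟨x, hx⟩
      rcases hS hx with h | h
      · exact ⟨Sum.inl ⟨x, hx, h⟩, rfl⟩
      · exact ⟨Sum.inr ⟨x, hx, h⟩, rfl⟩
  exact ⟨((Equiv.ofBijective g hbij).toHomeomorphOfContinuousOpen hg ho).symm⟩

lemma spine_of (hM : LocallyEuclidean 3 M) (β : B × ℝ → M) (hβ : IsOpenEmbedding β) (ε δ : ℝ)
    (h : ε < δ) (K' O1 O2 : Set M) (h1 : IsOpen O1) (h2 : IsOpen O2) (hd : Disjoint O1 O2)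
    (hK' : K' ⊆ β '' (univ ×ˢ Ioo ε δ))
    (hS : β '' (univ ×ˢ Icc ε δ) \ K' ⊆ O1 ∪ O2)
    (hh1 : Nonempty (((β '' (univ ×ˢ Icc ε δ) \ K') ∩ O1 : Set M) ≃ₜ B × Ici (0:ℝ)))
    (hh2 : Nonempty (((β '' (univ ×ˢ Icc ε δ) \ K') ∩ O2 : Set M) ≃ₜ B × Ici (0:ℝ))) :
    IsSpine 3 (β '' (univ ×ˢ Icc ε δ)) K' := by
  constructor
  · refine hK'.trans (interior_maximal (image_mono (prod_mono le_rfl Ioo_subset_Icc_self)) ?_)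
    exact hβ.isOpenMap _ (isOpen_univ.prod isOpen_Ioo)
  · obtain ⟨k⟩ := sum_homeo _ O1 O2 h1 h2 hd hS
    obtain ⟨k1⟩ := hh1
    obtain ⟨k2⟩ := hh2
    obtain ⟨k3⟩ := boundary_homeo hM β hβ ε δ h
    exact ⟨((k.trans (k1.sumCongr k2)).trans Homeomorph.sumProdDistrib.symm).trans
      (k3.symm.prodCongr (Homeomorph.refl _))⟩
end bdry

section dyn
variable {M : Type*} [TopologicalSpace M]

lemma hpow_iter (f : M ≃ₜ M) (n : ℕ) : ⇑(f ^ n) = (⇑f)^[n] := by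
  induction n with
  | zero => rfl
  | succ n ih => rw [pow_succ, Function.iterate_succ, ← ih]; rfl

lemma hmul_apply (f g : M ≃ₜ M) (x : M) : (f * g) x = f (g x) := rfl

lemma mem_img (f : M ≃ₜ M) (S : Set M) (x : M) : x ∈ f '' S ↔ f⁻¹ x ∈ S := by
  constructor
  · rintro ⟨y, hy, rfl⟩
    rw [← hmul_apply, inv_mul_cancel]; exact hy
  · intro h
    exact ⟨_, h, by rw [← hmul_apply, mul_inv_cancel]; rfl⟩

variable [T2Space M]

lemma cpt_inter (D : Set M) (hD : IsCompact D) (T : ℕ → Set M) (hT : Antitone T)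
    (hTc : ∀ n, IsClosed (T n)) (W : Set M) (hW : IsOpen W) (h : ∀ x ∈ D, (∀ n, x ∈ T n) → x ∈ W) :
    ∃ n, ∀ x ∈ D, x ∈ T n → x ∈ W := by
  obtain ⟨n, hn⟩ := exists_subset_nhds_of_isCompact' (V := fun n => D ∩ T n) (U := W)
    (Antitone.directed_ge (fun i j hij => inter_subset_inter_right _ (hT hij)))
    (fun i => hD.inter_right (hTc i)) (fun i => hD.isClosed.inter (hTc i)) (by
      intro x hx
      rw [mem_iInter] at hx
      exact hW.mem_nhds (h x (hx 0).1 (fun n => (hx n).2)))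
  exact ⟨n, fun x h1 h2 => hn ⟨h1, h2⟩⟩

lemma as_of_attractor [LocallyCompactSpace M] (f : M ≃ₜ M) (K : Set M) (h : IsAttractor f K) :
    f '' K = K ∧ ∃ U' ∈ 𝓝ˢ K, ∀ V ∈ 𝓝ˢ K, ∃ n : ℕ, ∀ j ≥ n, ∀ x ∈ U', (f ^ j) x ∈ V := by
  obtain ⟨hKc, U, hU, hK⟩ := h
  set T : ℕ → Set M := fun n => closure (⋃ (k : ℕ) (_ : n ≤ k), f^[k] '' U) with hT
  have hTanti : Antitone T := by
    intro n n' hn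
    apply closure_mono
    refine iUnion_mono (fun k => ?_)
    exact iUnion_subset (fun hk => subset_iUnion_of_subset (hn.trans hk) le_rfl)
  have hKT : ∀ x, x ∈ K ↔ ∀ n, x ∈ T n := by
    intro x
    conv_lhs => rw [hK]
    simp only [omegaSet, mem_iInter]
    constructor
    · intro h n
      exact hTanti (Nat.le_succ n) (h (n+1) (by omega))
    · intro h n _; exact h n
  have hfT : ∀ n, f '' (T n) = T (n+1) := by
    intro n
    simp only [hT]
    rw [f.image_closure]
    congr 1
    ext x
    simp only [mem_image, mem_iUnion, exists_prop]
    constructor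
    · rintro ⟨_, ⟨k, hk, u, hu, rfl⟩, rfl⟩
      exact ⟨k+1, by omega, u, hu, Function.iterate_succ_apply' _ _ _⟩
    · rintro ⟨k, hk, u, hu, rfl⟩
      obtain ⟨k, rfl⟩ : ∃ k', k = k'+1 := ⟨k-1, by omega⟩
      exact ⟨_, ⟨k, by omega, u, hu, rfl⟩, (Function.iterate_succ_apply' _ _ _).symm⟩
  have hfK : f '' K = K := by
    ext x
    rw [hKT x]
    constructor
    · rintro ⟨y, hy, rfl⟩ n
      refine hTanti (Nat.le_succ n) ?_
      rw [← hfT]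
      exact ⟨y, (hKT y).1 hy n, rfl⟩
    · intro h
      refine ⟨f.symm x, ?_, by simp⟩
      rw [hKT]
      intro n
      have := h (n+1)
      rw [← hfT] at this
      obtain ⟨y, hy, rfl⟩ := this
      simpa using hy
  refine ⟨hfK, ?_⟩
  have hfnK : ∀ (n : ℕ), ∀ x ∈ K, (f ^ n) x ∈ K := by
    intro n
    induction n with
    | zero => intro x hx; exact hx
    | succ n ih =>
      intro x hx
      rw [pow_succ', hmul_apply, ← hfK]
      exact ⟨_, ih x hx, rfl⟩
  obtain ⟨P, hPc, hKP⟩ := exists_compact_superset hKc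
  obtain ⟨n, hn⟩ := cpt_inter (f '' P) (hPc.image f.continuous) T hTanti
    (fun n => isClosed_closure) (interior P) isOpen_interior
    (fun x _ hx => hKP ((hKT x).2 hx))
  have hmemT : ∀ j, ∀ x ∈ U, (f ^ j) x ∈ T j := by
    intro j x hx
    apply subset_closure
    simp only [mem_iUnion, exists_prop]
    exact ⟨j, le_rfl, x, hx, by rw [hpow_iter]⟩
  refine ⟨U ∩ (f ^ n) ⁻¹' P, ?_, ?_⟩
  · refine Filter.inter_mem hU ?_
    rw [← subset_interior_iff_mem_nhdsSet]
    refine Subset.trans ?_ (preimage_interior_subset_interior_preimage (f ^ n).continuous)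
    intro x hx
    exact hKP (hfnK n x hx)
  · intro V hV
    have hP : ∀ j, n ≤ j → ∀ x ∈ U ∩ (f ^ n) ⁻¹' P, (f ^ j) x ∈ P := by
      intro j hj x hx
      induction j, hj using Nat.le_induction with
      | base => exact hx.2
      | succ j hj ih =>
        apply interior_subset
        refine hn _ ?_ (hTanti (by omega) (hmemT (j+1) x hx.1))
        rw [pow_succ', hmul_apply]
        exact ⟨_, ih, rfl⟩
    obtain ⟨n', hn'⟩ := cpt_inter P hPc T hTanti (fun n => isClosed_closure) (interior V)
      isOpen_interior (fun x _ hx => subset_interior_iff_mem_nhdsSet.2 hV ((hKT x).2 hx))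
    refine ⟨max n n', fun j hj x hx => interior_subset (hn' _ (hP j (le_of_max_le_left hj) x hx) ?_)⟩
    exact hTanti (le_of_max_le_right hj) (hmemT j x hx.1)

end dyn
set_option linter.unusedSectionVars false

section lev
variable {M : Type*} [TopologicalSpace M] {B : Type*} [TopologicalSpace B]

def levN (K : Set M) (β : B × ℝ → M) (t : ℝ) : Set M := K ∪ β '' (univ ×ˢ Iic t)
def levO (K : Set M) (β : B × ℝ → M) (t : ℝ) : Set M := K ∪ β '' (univ ×ˢ Iio t)

structure Coll (K : Set M) (β : B × ℝ → M) : Prop where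
  emb : IsOpenEmbedding β
  notK : ∀ z, β z ∉ K
  cpt : ∀ t, IsCompact (levN K β t)
  opn : ∀ t, IsOpen (levO K β t)
  nhd : ∀ V ∈ 𝓝ˢ K, ∃ t, levN K β t ⊆ V

variable {K : Set M} {β : B × ℝ → M}

lemma Coll.memN (h : Coll K β) (y : B) (t s : ℝ) : β (y, t) ∈ levN K β s ↔ t ≤ s := by
  constructor
  · rintro (h1 | ⟨⟨y', t'⟩, ⟨-, h1⟩, h2⟩)
    · exact absurd h1 (h.notK _)
    · have := h.emb.injective h2
      simp only [Prod.mk.injEq] at this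
      rw [← this.2]; exact h1
  · intro h1
    exact Or.inr ⟨(y, t), ⟨mem_univ _, h1⟩, rfl⟩

lemma Coll.memO (h : Coll K β) (y : B) (t s : ℝ) : β (y, t) ∈ levO K β s ↔ t < s := by
  constructor
  · rintro (h1 | ⟨⟨y', t'⟩, ⟨-, h1⟩, h2⟩)
    · exact absurd h1 (h.notK _)
    · have := h.emb.injective h2
      simp only [Prod.mk.injEq] at this
      rw [← this.2]; exact h1
  · intro h1
    exact Or.inr ⟨(y, t), ⟨mem_univ _, h1⟩, rfl⟩

lemma levK_sub (t : ℝ) : K ⊆ levO K β t := subset_union_left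
lemma levN_mono {s t : ℝ} (h : s ≤ t) : levN K β s ⊆ levN K β t :=
  union_subset_union_right _ (image_mono (prod_mono le_rfl (Iic_subset_Iic.2 h)))
lemma levO_mono {s t : ℝ} (h : s ≤ t) : levO K β s ⊆ levO K β t :=
  union_subset_union_right _ (image_mono (prod_mono le_rfl (Iio_subset_Iio h)))
lemma levO_sub_N {s t : ℝ} (h : s ≤ t) : levO K β s ⊆ levN K β t :=
  union_subset_union_right _ (image_mono (prod_mono le_rfl
    ((Iio_subset_Iio h).trans Iio_subset_Iic_self)))
lemma levN_sub_O {s t : ℝ} (h : s < t) : levN K β s ⊆ levO K β t :=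
  union_subset_union_right _ (image_mono (prod_mono le_rfl (Iic_subset_Iio.2 h)))

lemma Coll.nO (h : Coll K β) {x : M} {s t : ℝ} (h1 : x ∈ levN K β s) (h2 : x ∉ levO K β t) :
    ∃ y u, t ≤ u ∧ u ≤ s ∧ x = β (y, u) := by
  rcases h1 with h1 | ⟨⟨y, u⟩, ⟨-, hu⟩, rfl⟩
  · exact absurd (levK_sub t h1) h2
  · rw [h.memO, not_lt] at h2
    exact ⟨y, u, h2, hu, rfl⟩

lemma Coll.nN (h : Coll K β) {x : M} {s t : ℝ} (h1 : x ∈ levN K β s) (h2 : x ∉ levN K β t) :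
    ∃ y u, t < u ∧ u ≤ s ∧ x = β (y, u) := by
  rcases h1 with h1 | ⟨⟨y, u⟩, ⟨-, hu⟩, rfl⟩
  · exact absurd (Or.inl h1) h2
  · rw [h.memN, not_le] at h2
    exact ⟨y, u, h2, hu, rfl⟩

lemma Coll.shell (h : Coll K β) (s t : ℝ) :
    β '' (univ ×ˢ Icc s t) = levN K β t \ levO K β s := by
  ext x
  constructor
  · rintro ⟨⟨y, u⟩, ⟨-, hu⟩, rfl⟩
    refine ⟨(h.memN _ _ _).2 hu.2, fun h' => ?_⟩
    rw [h.memO] at h'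
    exact absurd hu.1 (not_le.2 h')
  · rintro ⟨h1, h2⟩
    obtain ⟨y, u, a, b, rfl⟩ := h.nO h1 h2
    exact ⟨_, ⟨mem_univ _, a, b⟩, rfl⟩

variable [T2Space M] [CompactSpace B]

lemma fpow_inv_cancel (F : M ≃ₜ M) (i : ℕ) (x : M) : (F ^ i) ((F ^ i)⁻¹ x) = x := by
  rw [← hmul_apply, mul_inv_cancel]; rfl

lemma outer_collar (hc : Coll K β) (F : M ≃ₜ M) (η0 η θ δ : ℝ) (h1 : η0 < η) (h2 : η < θ)
    (h3 : θ < δ) (hF1 : F '' levN K β δ ⊆ levO K β θ) (hF2 : levN K β η ⊆ F '' levO K β θ)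
    (A : Set M) (hA : A = ⋂ k : ℕ, (F ^ k) '' levN K β δ) (hAη : A ⊆ levO K β η0) :
    Nonempty ((levN K β δ \ A : Set M) ≃ₜ B × Ici (0:ℝ)) := by
  have hsucc : ∀ (i : ℕ) (S : Set M), (F ^ (i+1)) '' S = (F ^ i) '' (F '' S) := by
    intro i S
    rw [← image_comp, pow_succ]; rfl
  have hdec1 : ∀ i : ℕ, (F ^ (i+1)) '' levN K β δ ⊆ (F ^ i) '' levN K β δ := by
    intro i
    rw [hsucc]
    exact image_mono (hF1.trans (levO_sub_N h3.le))
  have hdec : Antitone (fun i : ℕ => (F ^ i) '' levN K β δ) := antitone_nat_of_succ_le hdec1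
  have hAi : ∀ i : ℕ, A ⊆ (F ^ i) '' levN K β δ := by
    intro i; rw [hA]; exact iInter_subset _ i
  have hAinv : ∀ (i : ℕ), ∀ x ∈ A, (F ^ i)⁻¹ x ∈ A := by
    intro i x hx
    rw [hA, mem_iInter]
    intro k
    have := hAi (i + k) hx
    rw [mem_img] at this ⊢
    rw [← hmul_apply, ← mul_inv_rev, ← pow_add]
    exact this
  have hAO : ∀ (i : ℕ) (t : ℝ), η0 ≤ t → A ⊆ (F ^ i) '' levO K β t := by
    intro i t ht x hx
    rw [mem_img]
    exact levO_mono ht (hAη (hAinv i x hx))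
  have himg : ∀ i : ℕ, (F ^ (i+1)) '' levN K β δ ⊆ levO K β θ := by
    intro i
    have : (F ^ (i+1)) '' levN K β δ ⊆ ⇑(F ^ (1:ℕ)) '' levN K β δ := hdec (show 1 ≤ i + 1 by omega)
    rw [pow_one] at this
    exact this.trans hF1
  have hneg : IsOpenEmbedding (fun z : B × ℝ => ((z.1, -z.2) : B × ℝ)) :=
    ((Homeomorph.refl B).prodCongr (Homeomorph.neg ℝ)).isOpenEmbedding
  have hβ' : IsOpenEmbedding (fun z : B × ℝ => β (z.1, -z.2)) := hc.emb.comp hneg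
  refine collar_engulf (fun z : B × ℝ => β (z.1, -z.2)) hβ' (levN K β δ \ A) (-δ) (-θ) (-η0)
    (by linarith) (by linarith) ?_ ?_ (fun i => levN K β δ \ (F ^ (i+1)) '' levO K β θ) ?_ ?_ ?_
    (fun i z => (F ^ (i+1)) (β (z.1, -z.2))) ?_ (-δ) (-θ) (-η) (-η0) (by linarith) (by linarith)
    (by linarith) ?_ ?_ ?_ ?_ ?_
  · intro y t ht1 ht2
    refine ⟨(hc.memN _ _ _).2 (by linarith), fun h => ?_⟩
    have := (hc.memO _ _ _).1 (hAη h)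
    linarith
  · intro y t ht h
    have := (hc.memN _ _ _).1 h.1
    linarith
  · intro i
    exact (hc.cpt δ).diff ((F ^ (i+1)).isOpenMap _ (hc.opn θ))
  · intro i
    exact sdiff_subset_sdiff_right (hAO _ _ (by linarith))
  · intro L hL hLc
    obtain ⟨i, hi⟩ := cpt_inter L hLc _ hdec
      (fun i => ((hc.cpt δ).image (F ^ i).continuous).isClosed) ∅ isOpen_empty (by
        intro x hx hx'
        refine (hL hx).2 ?_
        rw [hA, mem_iInter]; exact hx')
    refine ⟨i, fun x hx => ⟨(hL hx).1, fun h => hi x hx ?_⟩⟩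
    exact hdec1 i (image_mono (levO_sub_N h3.le) h)
  · intro i
    exact (F ^ (i+1)).isOpenEmbedding.comp hβ'
  · intro i y t ht1 ht2
    have hmem : (F ^ (i+1)) (β (y, -t)) ∈ levO K β θ :=
      himg i ⟨_, (hc.memN _ _ _).2 (by linarith), rfl⟩
    refine ⟨⟨levO_sub_N h3.le hmem, fun h => ?_⟩, ?_⟩
    · have := hAO (i+1) η0 le_rfl h
      obtain ⟨z, hz, he⟩ := this
      have := (F ^ (i+1)).injective he
      rw [this] at hz
      have := (hc.memO _ _ _).1 hz
      linarith
    · intro y' t' ht' he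
      simp only at he
      rw [← he] at hmem
      have := (hc.memO _ _ _).1 hmem
      linarith
  · intro x hx
    have hx2 : x ∉ levN K β η := fun h => hx.2 (by
      rw [zero_add, pow_one]; exact hF2 h)
    obtain ⟨y, u, a, b, rfl⟩ := hc.nN hx.1 hx2
    exact ⟨y, -u, by linarith, by linarith, by simp⟩
  · intro i y t ht1 ht2
    refine ⟨levO_sub_N h3.le (himg i ⟨_, (hc.memN _ _ _).2 (by linarith), rfl⟩), ?_⟩
    rintro ⟨z, hz, he⟩
    have := (F ^ (i+1)).injective he
    rw [this] at hz
    have := (hc.memO _ _ _).1 hz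
    linarith
  · intro i y t h ht
    by_contra hlt
    exact h.2 ⟨_, (hc.memO _ _ _).2 (by linarith), rfl⟩
  · intro i x hx
    by_cases hx1 : x ∈ (F ^ (i+1)) '' levO K β θ
    · right
      obtain ⟨z, hz, rfl⟩ := hx1
      have hz2 : z ∉ levN K β η := by
        intro h
        refine hx.2 ?_
        rw [hsucc]
        exact ⟨z, hF2 h, rfl⟩
      obtain ⟨y, u, a, b, rfl⟩ := hc.nN (levO_sub_N h3.le hz) hz2
      exact ⟨y, -u, by linarith, by linarith, by simp⟩
    · exact Or.inl ⟨hx.1, hx1⟩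

lemma inner_collar (hc : Coll K β) (f : M ≃ₜ M) (ε τ ε1 p q e0 : ℝ) (h1 : ε < τ) (h2 : τ < ε1)
    (h3 : ε1 < p) (h4 : p ≤ q) (h5 : q < e0)
    (hf1 : ∀ i : ℕ, ∀ x ∈ levN K β τ, (f ^ i)⁻¹ x ∈ levO K β ε1)
    (hf2 : f '' levN K β p ⊆ levO K β q)
    (R : Set M) (hR : R = ⋃ k : ℕ, (f ^ k) '' levO K β e0)
    (hRc : ∀ L ⊆ R, IsCompact L → ∃ i : ℕ, L ⊆ (f ^ i) '' levO K β p) :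
    Nonempty ((R \ levO K β ε : Set M) ≃ₜ B × Ici (0:ℝ)) := by
  have hRk : ∀ k : ℕ, (f ^ k) '' levO K β e0 ⊆ R := by
    intro k; rw [hR]; exact subset_iUnion (fun k : ℕ => (f ^ k) '' levO K β e0) k
  have hR0 : levO K β e0 ⊆ R := by
    have := hRk 0
    rw [pow_zero] at this
    intro x hx
    exact this ⟨x, hx, rfl⟩
  have hno : ∀ (i : ℕ) y t, ε1 ≤ t → (f ^ i) (β (y, t)) ∉ levN K β τ := by
    intro i y t ht h
    have := hf1 i _ h
    rw [← hmul_apply, inv_mul_cancel] at this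
    have := (hc.memO _ _ _).1 this
    linarith
  have hno' : ∀ (i : ℕ) y t, ε1 ≤ t → (f ^ i) (β (y, t)) ∉ levO K β ε := by
    intro i y t ht h
    exact hno i y t ht (levO_sub_N h1.le h)
  refine collar_engulf β hc.emb (R \ levO K β ε) ε τ e0 h1 (by linarith) ?_ ?_
    (fun i => (f ^ i) '' levN K β p \ levO K β ε) ?_ ?_ ?_
    (fun i z => (f ^ i) (β z)) ?_ ε1 p q ((q + e0)/2) h3 h4 (by linarith) ?_ ?_ ?_ ?_ ?_
  · intro y t ht1 ht2
    refine ⟨hR0 ((hc.memO _ _ _).2 ht2), fun h => ?_⟩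
    have := (hc.memO _ _ _).1 h
    linarith
  · intro y t ht h
    exact h.2 ((hc.memO _ _ _).2 ht)
  · intro i
    exact ((hc.cpt p).image (f ^ i).continuous).diff (hc.opn ε)
  · intro i
    exact sdiff_subset_sdiff_left ((image_mono (levN_sub_O (by linarith))).trans (hRk i))
  · intro L hL hLc
    obtain ⟨i, hi⟩ := hRc L (hL.trans sdiff_subset) hLc
    exact ⟨i, fun x hx => ⟨image_mono (levO_sub_N le_rfl) (hi hx), (hL hx).2⟩⟩
  · intro i
    exact (f ^ i).isOpenEmbedding.comp hc.emb
  · intro i y t ht1 ht2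
    refine ⟨⟨hRk i ⟨_, (hc.memO _ _ _).2 (by linarith), rfl⟩, hno' i y t ht1⟩, ?_⟩
    intro y' t' ht' he
    refine hno i y t ht1 ?_
    rw [← he]
    exact (hc.memN _ _ _).2 ht'
  · intro x hx
    have hx1 : x ∈ levN K β p := by
      obtain ⟨z, hz, rfl⟩ := hx.1; exact hz
    obtain ⟨y, u, a, b, rfl⟩ := hc.nO hx1 hx.2
    exact ⟨y, u, a, by linarith, rfl⟩
  · intro i y t ht1 ht2
    exact ⟨⟨_, (hc.memN _ _ _).2 ht2, rfl⟩, hno' i y t ht1⟩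
  · intro i y t h _
    obtain ⟨z, hz, he⟩ := h.1
    rw [(f ^ i).injective he] at hz
    exact (hc.memN _ _ _).1 hz
  · rintro i x ⟨⟨z, hz, rfl⟩, hx⟩
    have hfz : (f ^ (i+1)) z = (f ^ i) (f z) := by rw [pow_succ]; rfl
    rw [hfz] at hx ⊢
    have hq : f z ∈ levO K β q := hf2 ⟨z, hz, rfl⟩
    by_cases hp : f z ∈ levN K β p
    · exact Or.inl ⟨⟨_, hp, rfl⟩, hx⟩
    · right
      obtain ⟨y, u, a, b, hu⟩ := hc.nN (levO_sub_N le_rfl hq) hp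
      exact ⟨y, u, by linarith, b, by rw [hu]⟩
end lev

section fixedlam
variable {M : Type*} [TopologicalSpace M] [T2Space M] [LocallyCompactSpace M]
  {B : Type*} [TopologicalSpace B] [CompactSpace B] {K : Set M} {β : B × ℝ → M}

lemma hsymm_inv (f : M ≃ₜ M) : f.symm = f⁻¹ := rfl

lemma Coll.nhd' (hc : Coll K β) (V : Set M) (hV : V ∈ 𝓝ˢ K) (s : ℝ) :
    ∃ t < s, levN K β t ⊆ V := by
  obtain ⟨t, ht⟩ := hc.nhd V hV
  exact ⟨min t (s - 1), by have := min_le_right t (s-1); linarith,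
    (levN_mono (min_le_left _ _)).trans ht⟩

lemma Coll.O_nhd (hc : Coll K β) (t : ℝ) : levO K β t ∈ 𝓝ˢ K :=
  (hc.opn t).mem_nhdsSet.2 (levK_sub t)

lemma inv_inv_pow (f : M ≃ₜ M) (k : ℕ) : (f ^ k)⁻¹ = f⁻¹ ^ k := (inv_pow f k).symm

lemma fixed_lambda (hM : LocallyEuclidean 3 M) (hc : Coll K β) (f : M ≃ₜ M)
    (hrep : IsRepeller f K) (η0 η θ δ : ℝ)
    (h1 : η0 < η) (h2 : η < θ) (h3 : θ < δ) (m j : ℕ) (hm : 1 ≤ m)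
    (hf1 : ∀ k, m ≤ k → k < 2 * m → ∀ x ∈ levN K β δ, (f ^ k) x ∈ levO K β δ)
    (hf2 : ∀ x ∈ levN K β δ, (f ^ m) x ∈ levO K β θ)
    (hf3 : ∀ x ∈ levN K β η, (f ^ m)⁻¹ x ∈ levO K β θ)
    (hf4 : ∀ x ∈ levN K β δ, (f ^ (m * j)) x ∈ levO K β η0) :
    ∃ K' : Set M, IsCompact K' ∧ IsAttractor f K' ∧ (∀ i : ℕ, K' ⊆ (f ^ (m * i)) '' levN K β δ) ∧
      ∃ ε < δ, IsSpine 3 (β '' (univ ×ˢ Icc ε δ)) K' := by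
  obtain ⟨hgK, U', hU', hst⟩ := as_of_attractor f.symm K hrep
  rw [hsymm_inv] at hgK hst
  set N := levN K β δ with hN
  set F := f ^ m with hF
  have hFpow : ∀ i : ℕ, F ^ i = f ^ (m * i) := fun i => (pow_mul f m i).symm
  set A := ⋂ k : ℕ, (F ^ k) '' N with hA
  -- trapping
  have htrap : ∀ k, m ≤ k → ∀ x ∈ N, (f ^ k) x ∈ N := by
    intro k
    induction k using Nat.strong_induction_on with
    | _ k ih =>
      intro hk x hx
      by_cases hk2 : k < 2 * m
      · exact levO_sub_N le_rfl (hf1 k hk hk2 x hx)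
      · have e : f ^ k = f ^ (k - m) * f ^ m := by rw [← pow_add]; congr 1; omega
        rw [e, hmul_apply]
        exact ih (k - m) (by omega) (by omega) _ (levO_sub_N h3.le (hf2 x hx))
  have hdeep : ∀ q k : ℕ, m * (q + 1) ≤ k → ∀ x ∈ N, (f ^ k) x ∈ (F ^ q) '' N := by
    intro q k hk x hx
    have e : f ^ k = f ^ (m * q) * f ^ (k - m * q) := by
      rw [← pow_add]; congr 1
      rw [mul_add] at hk; omega
    rw [e, hmul_apply, hFpow]
    refine ⟨_, htrap _ ?_ x hx, rfl⟩
    rw [mul_add] at hk; omega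
  have hAi : ∀ i : ℕ, A ⊆ (f ^ (m * i)) '' N := by
    intro i
    rw [← hFpow]; exact iInter_subset _ i
  have hAN : A ⊆ N := by
    intro x hx
    have := hAi 0 hx
    rw [mul_zero, pow_zero] at this
    obtain ⟨z, hz, rfl⟩ := this
    exact hz
  have hAc : IsCompact A := by
    refine (hc.cpt δ).of_isClosed_subset ?_ hAN
    exact isClosed_iInter (fun k => ((hc.cpt δ).image (F ^ k).continuous).isClosed)
  have hAη : A ⊆ levO K β η0 := by
    intro x hx
    obtain ⟨z, hz, rfl⟩ := hAi j hx
    exact hf4 z hz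
  have memA : ∀ x, (∀ q : ℕ, ∃ k, m * (q+1) ≤ k ∧ ∃ z ∈ N, x = (f ^ k) z) → x ∈ A := by
    intro x h
    rw [hA, mem_iInter]
    intro q
    obtain ⟨k, hk, z, hz, rfl⟩ := h q
    exact hdeep q k hk z hz
  have hAf : ∀ x ∈ A, f x ∈ A := by
    intro x hx
    apply memA
    intro q
    obtain ⟨z, hz, rfl⟩ := hAi (q+1) hx
    exact ⟨m * (q+1) + 1, by omega, z, hz, by rw [pow_succ', hmul_apply]⟩
  have hAg : ∀ x ∈ A, f⁻¹ x ∈ A := by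
    intro x hx
    apply memA
    intro q
    obtain ⟨z, hz, rfl⟩ := hAi (q+2) hx
    refine ⟨m * (q+2) - 1, ?_, z, hz, ?_⟩
    · have : m * (q+2) = m * (q+1) + m := by ring
      omega
    · have : m * (q+2) = (m * (q+2) - 1) + 1 := by
        have : m * (q+2) = m * (q+1) + m := by ring
        omega
      conv_lhs => rw [this]
      rw [pow_succ', ← hmul_apply, inv_mul_cancel_left]
  -- inner levels
  obtain ⟨e0, he0, he0U⟩ := hc.nhd' U' hU' η0
  have hfK : ∀ x ∈ K, f x ∈ K := by
    intro x hx
    rw [← hgK] at hx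
    obtain ⟨z, hz, rfl⟩ := hx
    rw [← hmul_apply, mul_inv_cancel]; exact hz
  have hgKn : ∀ (n : ℕ), ∀ x ∈ K, (f ^ n)⁻¹ x ∈ K := by
    intro n
    induction n with
    | zero => intro x hx; simpa using hx
    | succ n ih =>
      intro x hx
      rw [pow_succ', mul_inv_rev, hmul_apply]
      apply ih
      rw [← hgK]; exact ⟨x, hx, rfl⟩
  set q := e0 - 1 with hq
  obtain ⟨p, hpq, hp⟩ := hc.nhd' (f ⁻¹' levO K β q)
    (((hc.opn q).preimage f.continuous).mem_nhdsSet.2 (fun x hx => levK_sub q (hfK x hx))) q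
  set ε1 := p - 1 with hε1
  obtain ⟨n1, hn1⟩ := hst (levO K β ε1) (hc.O_nhd ε1)
  have hWn : (U' ∩ ⋂ i ∈ Finset.range n1, ((f ^ i)⁻¹ : M ≃ₜ M) ⁻¹' levO K β ε1) ∈ 𝓝ˢ K := by
    refine Filter.inter_mem hU' ?_
    rw [Filter.biInter_finset_mem]
    intro i _
    exact ((hc.opn ε1).preimage ((f ^ i)⁻¹ : M ≃ₜ M).continuous).mem_nhdsSet.2
      (fun x hx => levK_sub ε1 (hgKn i x hx))
  obtain ⟨τ, hτ, hτW⟩ := hc.nhd' _ hWn ε1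
  set ε := τ - 1 with hε
  have hin1 : ∀ i : ℕ, ∀ x ∈ levN K β τ, (f ^ i)⁻¹ x ∈ levO K β ε1 := by
    intro i x hx
    obtain ⟨ha, hb⟩ := hτW hx
    by_cases hi : i < n1
    · simp only [mem_iInter] at hb
      exact hb i (Finset.mem_range.2 hi)
    · rw [inv_inv_pow]
      exact hn1 i (not_lt.1 hi) x ha
  set R := ⋃ k : ℕ, (f ^ k) '' levO K β e0 with hR
  have hRk : ∀ k : ℕ, (f ^ k) '' levO K β e0 ⊆ R := by
    intro k; exact subset_iUnion (fun k : ℕ => (f ^ k) '' levO K β e0) k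
  have hR0 : levO K β e0 ⊆ R := by
    have := hRk 0
    rw [pow_zero] at this
    intro x hx
    exact this ⟨x, hx, rfl⟩
  have hRo : IsOpen R := isOpen_iUnion (fun k => (f ^ k).isOpenMap _ (hc.opn e0))
  -- pulling back
  have hpull : ∀ t, ∃ n : ℕ, ∀ i ≥ n, ∀ x ∈ levO K β e0, (f ^ i)⁻¹ x ∈ levO K β t := by
    intro t
    obtain ⟨n, hn⟩ := hst (levO K β t) (hc.O_nhd t)
    refine ⟨n, fun i hi x hx => ?_⟩
    rw [inv_inv_pow]
    exact hn i hi x (he0U (levO_sub_N le_rfl hx))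
  have hRA : R ⊆ A := by
    intro x hx
    rw [hR, mem_iUnion] at hx
    obtain ⟨k, z, hz, rfl⟩ := hx
    obtain ⟨n, hn⟩ := hpull δ
    apply memA
    intro q'
    refine ⟨k + (n + m * (q'+1)), by omega, _, levO_sub_N le_rfl (hn (n + m * (q'+1)) (by omega) z hz), ?_⟩
    rw [pow_add, hmul_apply, fpow_inv_cancel]
  have hRf : ∀ x ∈ R, f x ∈ R := by
    intro x hx
    rw [hR, mem_iUnion] at hx
    obtain ⟨k, z, hz, rfl⟩ := hx
    exact hRk (k+1) ⟨z, hz, by rw [pow_succ', hmul_apply]⟩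
  have hRg : ∀ x ∈ R, f⁻¹ x ∈ R := by
    intro x hx
    rw [hR, mem_iUnion] at hx
    obtain ⟨k, z, hz, rfl⟩ := hx
    obtain ⟨n, hn⟩ := hpull e0
    refine hRk (k + n) ⟨_, hn (n+1) (by omega) z hz, ?_⟩
    rw [← hmul_apply, ← hmul_apply]
    congr 1
    rw [mul_inv_eq_iff_eq_mul, mul_assoc, ← pow_add, eq_inv_mul_iff_mul_eq, ← pow_succ']
    congr 1
  set K' := A \ R with hK'
  have hK'c : IsCompact K' := hAc.diff hRo
  have hK'g : ∀ x ∈ K', f⁻¹ x ∈ K' := by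
    intro x hx
    refine ⟨hAg x hx.1, fun h => hx.2 ?_⟩
    have := hRf _ h
    rwa [← hmul_apply, mul_inv_cancel] at this
  have hK'gn : ∀ n : ℕ, ∀ x ∈ K', (f ^ n)⁻¹ x ∈ K' := by
    intro n
    induction n with
    | zero => intro x hx; simpa using hx
    | succ n ih =>
      intro x hx
      rw [pow_succ', mul_inv_rev, hmul_apply]
      exact ih _ (hK'g x hx)
  have hK'sub : K' ⊆ β '' (univ ×ˢ Ioo ε δ) := by
    intro x hx
    have hx1 := hAη hx.1
    have hx2 : x ∉ levO K β e0 := fun h => hx.2 (hR0 h)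
    obtain ⟨y, u, a, b, rfl⟩ := hc.nO (levO_sub_N le_rfl hx1) hx2
    refine ⟨_, ⟨mem_univ _, ?_, ?_⟩, rfl⟩ <;> simp only <;> linarith
  have hεδ : ε < δ := by linarith
  have hshell := hc.shell ε δ
  set C := β '' (univ ×ˢ Icc ε δ) with hC
  have hOεR : levO K β ε ⊆ R := (levO_mono (by linarith)).trans hR0
  have hspine : IsSpine 3 C K' := by
    refine spine_of hM β hc.emb ε δ hεδ K' Aᶜ R hAc.isClosed.isOpen_compl hRo
      (disjoint_left.2 fun x hx hx' => hx (hRA hx')) hK'sub ?_ ?_ ?_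
    · intro x hx
      by_cases hxA : x ∈ A
      · right
        by_contra hxR
        exact hx.2 ⟨hxA, hxR⟩
      · exact Or.inl hxA
    · have e : (β '' (univ ×ˢ Icc ε δ) \ K') ∩ Aᶜ = N \ A := by
        rw [← hC, hshell]
        ext x
        constructor
        · rintro ⟨⟨⟨a, -⟩, -⟩, b⟩; exact ⟨a, b⟩
        · rintro ⟨a, b⟩
          exact ⟨⟨⟨a, fun h => b (hRA (hOεR h))⟩, fun h => b h.1⟩, b⟩
      rw [e]
      refine outer_collar hc F η0 η θ δ h1 h2 h3 ?_ ?_ A hA hAη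
      · rintro _ ⟨z, hz, rfl⟩; exact hf2 z hz
      · intro x hx
        rw [mem_img]; exact hf3 x hx
    · have e : (β '' (univ ×ˢ Icc ε δ) \ K') ∩ R = R \ levO K β ε := by
        rw [← hC, hshell]
        ext x
        constructor
        · rintro ⟨⟨⟨-, a⟩, -⟩, b⟩; exact ⟨b, a⟩
        · rintro ⟨a, b⟩
          exact ⟨⟨⟨hAN (hRA a), b⟩, fun h => h.2 a⟩, a⟩
      rw [e]
      refine inner_collar hc f ε τ ε1 p q e0 (by linarith) hτ (by linarith) hpq.le (by linarith)
        hin1 ?_ R hR ?_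
      · rintro _ ⟨z, hz, rfl⟩; exact hp hz
      · intro L hL hLc
        obtain ⟨s, hs⟩ := hLc.elim_finite_subcover (fun k : ℕ => (f ^ k) '' levO K β e0)
          (fun k => (f ^ k).isOpenMap _ (hc.opn e0)) hL
        obtain ⟨n, hn⟩ := hpull p
        refine ⟨s.sup id + n, fun x hx => ?_⟩
        have := hs hx
        simp only [mem_iUnion] at this
        obtain ⟨k, hk, z, hz, rfl⟩ := this
        have hks : k ≤ s.sup id := Finset.le_sup (f := id) hk
        refine ⟨_, hn (s.sup id + n - k) (by omega) z hz, ?_⟩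
        have e : s.sup id + n = k + (s.sup id + n - k) := by omega
        conv_lhs => rw [e]
        rw [pow_add, hmul_apply]
        congr 1
        have e2 : k + (s.sup id + n - k) - k = s.sup id + n - k := by omega
        rw [e2, fpow_inv_cancel]
  refine ⟨K', hK'c, ⟨hK'c, C, ?_, ?_⟩, fun i => sdiff_subset.trans (hAi i), ε, hεδ, hspine⟩
  · exact subset_interior_iff_mem_nhdsSet.1 hspine.1
  · have hK'C : K' ⊆ C := hspine.1.trans interior_subset
    apply Subset.antisymm
    · intro x hx
      simp only [omegaSet, mem_iInter]
      intro n _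
      apply subset_closure
      simp only [mem_iUnion, exists_prop]
      refine ⟨n, le_rfl, (f ^ n)⁻¹ x, hK'C (hK'gn n x hx), ?_⟩
      rw [← hpow_iter, fpow_inv_cancel]
    · intro x hx
      simp only [omegaSet, mem_iInter] at hx
      constructor
      · rw [hA, mem_iInter]
        intro q'
        have h0 := hx (m * (q'+1)) (Nat.mul_pos hm (by omega))
        refine closure_minimal ?_ ((hc.cpt δ).image (F ^ q').continuous).isClosed h0
        refine iUnion_subset fun k => iUnion_subset fun hk => ?_
        rintro _ ⟨z, hz, rfl⟩
        rw [← hpow_iter]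
        rw [hshell] at hz
        exact hdeep q' k hk z hz.1
      · intro hxR
        rw [hR, mem_iUnion] at hxR
        obtain ⟨i, hi⟩ := hxR
        obtain ⟨n, hn⟩ := hpull ε
        have h0 := hx (i + n + 1) (by omega)
        rw [mem_closure_iff] at h0
        obtain ⟨w, hw1, hw2⟩ := h0 _ ((f ^ i).isOpenMap _ (hc.opn e0)) hi
        simp only [mem_iUnion, exists_prop] at hw2
        obtain ⟨k, hk, c, hcC, rfl⟩ := hw2
        obtain ⟨o, ho, heq⟩ := hw1
        rw [← hpow_iter] at heq
        rw [hshell] at hcC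
        apply hcC.2
        have : c = (f ^ (k - i))⁻¹ o := by
          have e : f ^ k = f ^ i * f ^ (k - i) := by rw [← pow_add]; congr 1; omega
          rw [e, hmul_apply] at heq
          have := (f ^ i).injective heq
          rw [this, ← hmul_apply, inv_mul_cancel]; rfl
        rw [this]
        exact hn _ (by omega) o ho
end fixedlam

theorem fam_pow_cont {M : Type*} [TopologicalSpace M] (f : unitInterval → M ≃ₜ M)
    (hf : ContinuousFamily f) (k : ℕ) :
    Continuous (fun p : unitInterval × M => (f p.1 ^ k) p.2) ∧
    Continuous (fun p : unitInterval × M => ((f p.1 ^ k)⁻¹) p.2) := by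
  induction k with
  | zero => exact ⟨by simpa using continuous_snd, by simpa using continuous_snd⟩
  | succ k ih =>
    constructor
    · have h : (fun p : unitInterval × M => (f p.1 ^ (k+1)) p.2)
          = fun p => (fun q : unitInterval × M => f q.1 q.2) (p.1, (f p.1 ^ k) p.2) := by
        funext p
        rw [pow_succ', hmul_apply]
      rw [h]
      exact hf.1.comp (continuous_fst.prodMk ih.1)
    · have h : (fun p : unitInterval × M => ((f p.1 ^ (k+1))⁻¹) p.2)
          = fun p => (fun q : unitInterval × M => ((f q.1 ^ k)⁻¹) q.2)
              (p.1, (f p.1).symm p.2) := by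
        funext p
        rw [pow_succ', mul_inv_rev, hmul_apply]
        rfl
      rw [h]
      exact ih.2.comp (continuous_fst.prodMk hf.2)

theorem fam_near {M : Type*} [TopologicalSpace M] (g : unitInterval → M → M)
    (hg : Continuous (fun p : unitInterval × M => g p.1 p.2))
    (D W : Set M) (hD : IsCompact D) (hW : IsOpen W) (h : ∀ x ∈ D, g 0 x ∈ W) :
    ∀ᶠ lam in 𝓝 (0 : unitInterval), ∀ x ∈ D, g lam x ∈ W := by
  obtain ⟨u, v, hu, hv, h0, hDv, huv⟩ := generalized_tube_lemma
    (isCompact_singleton (x := (0 : unitInterval))) hD (hW.preimage hg)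
    (by rintro ⟨a, b⟩ ⟨ha, hb⟩
        rw [mem_singleton_iff] at ha
        dsimp only at ha hb
        subst ha
        exact h b hb)
  filter_upwards [hu.mem_nhds (h0 rfl)] with lam hl x hx
  exact huv (mk_mem_prod hl (hDv hx))

theorem ev_zero {p : unitInterval → Prop} (h : ∀ᶠ lam in 𝓝 (0 : unitInterval), p lam) :
    ∃ r : ℝ, 0 < r ∧ ∀ lam : unitInterval, (lam : ℝ) < r → p lam := by
  obtain ⟨r, hr, h⟩ := Metric.eventually_nhds_iff.1 h
  refine ⟨r, hr, fun lam hl => h ?_⟩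
  rw [Subtype.dist_eq, Real.dist_eq]
  simpa [abs_of_nonneg lam.2.1] using hl

/-- **Hopf bifurcation of a bicollared closed surface in a 3-manifold.** If `K ⊆ M` is a
bicollared compact set, each of whose points has an open neighborhood in `K`
homeomorphic to `ℝ²`, which is an attractor of `f₀` and a repeller of `f_λ` for every
`λ > 0`, then for all sufficiently small `λ > 0` there is a compact attractor `K_λ` of
`f_λ` which is a topological spine of a compact subset of `M` homeomorphic to
`(K × Fin 2) × [0,1]`, converging to `K` upper semicontinuously as `λ → 0`. -/
theorem hopf_closed_surface
    {M : Type*} [MetricSpace M] [LocallyCompactSpace M]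
    (hM : LocallyEuclidean 3 M)
    (K : Set M) (hKc : IsCompact K)
    (hsurf : ∀ x : ↥K, ∃ V : Set ↥K, IsOpen V ∧ x ∈ V ∧
      Nonempty (↥V ≃ₜ EuclideanSpace ℝ (Fin 2)))
    (hbicol : Bicollared K)
    (f : unitInterval → M ≃ₜ M) (hf : ContinuousFamily f)
    (hKattr : IsAttractor (f 0) K)
    (hhopf : ∀ lam : unitInterval, 0 < (lam : ℝ) → IsRepeller (f lam) K) :
    ∃ lam₀ : ℝ, 0 < lam₀ ∧ ∃ Kfam : unitInterval → Set M,
      (∀ lam : unitInterval, 0 < (lam : ℝ) → (lam : ℝ) < lam₀ →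
        IsCompact (Kfam lam) ∧ IsAttractor (f lam) (Kfam lam) ∧
        ∃ C : Set M, IsCompact C ∧
          Nonempty (↥C ≃ₜ (↥K × Fin 2) × ↥(Set.Icc (0 : ℝ) 1)) ∧
          IsSpine 3 C (Kfam lam)) ∧
      (∀ V : Set M, V ∈ 𝓝ˢ K → ∃ lam₁ : ℝ, 0 < lam₁ ∧
        ∀ lam : unitInterval, 0 < (lam : ℝ) → (lam : ℝ) < lam₁ → Kfam lam ⊆ V) := by
  haveI : CompactSpace K := isCompact_iff_compactSpace.1 hKc
  obtain ⟨β, hb1, hb2, hb3, hb4, hb5⟩ := exists_beta hM K hKc hsurf hbicol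
  have hc : Coll K β := ⟨hb1, hb2, hb3, hb4, hb5⟩
  obtain ⟨hK0, U', hU', hst⟩ := as_of_attractor (f 0) K hKattr
  obtain ⟨δ, hδ⟩ := hb5 U' hU'
  have hst' : ∀ V ∈ 𝓝ˢ K, ∃ n : ℕ, ∀ j ≥ n, ∀ x ∈ levN K β δ, (f 0 ^ j) x ∈ V := by
    intro V hV
    obtain ⟨n, hn⟩ := hst V hV
    exact ⟨n, fun j hj x hx => hn j hj x (hδ hx)⟩
  have hNc : ∀ t, IsCompact (levN K β t) := hb3
  have hOo : ∀ t, IsOpen (levO K β t) := hb4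
  obtain ⟨n, hn⟩ := hst' (levO K β (δ - 1)) (hc.O_nhd (δ - 1))
  obtain ⟨m, hm1, hmn⟩ : ∃ m : ℕ, 1 ≤ m ∧ n ≤ m := ⟨max n 1, le_max_right _ _, le_max_left _ _⟩
  have hKpow : ∀ k : ℕ, ∀ x ∈ K, (f 0 ^ k) x ∈ K := by
    intro k
    induction k with
    | zero => intro x hx; simpa using hx
    | succ k ih =>
      intro x hx
      rw [pow_succ', hmul_apply, ← hK0]
      exact mem_image_of_mem _ (ih x hx)
  have hKinv : ∀ k : ℕ, ∀ x ∈ K, (f 0 ^ k)⁻¹ x ∈ K := by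
    intro k
    induction k with
    | zero => intro x hx; simpa using hx
    | succ k ih =>
      intro x hx
      rw [pow_succ', mul_inv_rev, hmul_apply]
      apply ih
      rw [← hK0] at hx
      exact (mem_img _ _ _).1 hx
  obtain ⟨η, hη, hηs⟩ := hc.nhd' (s := δ - 1) (V := ⇑((f 0 ^ m)⁻¹) ⁻¹' levO K β (δ - 1))
    (((hOo (δ - 1)).preimage ((f 0 ^ m)⁻¹).continuous).mem_nhdsSet.2
      (fun x hx => subset_of_mem_nhdsSet (hc.O_nhd (δ - 1)) (hKinv m x hx)))
  obtain ⟨j, hj⟩ := hst' (levO K β (η - 1)) (hc.O_nhd (η - 1))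
  have e1 : ∀ᶠ lam in 𝓝 (0 : unitInterval), ∀ k ∈ Finset.Ico m (2*m), ∀ x ∈ levN K β δ,
      (f lam ^ k) x ∈ levO K β δ := by
    rw [Filter.eventually_all_finset]
    intro k hk
    rw [Finset.mem_Ico] at hk
    exact fam_near (fun l x => (f l ^ k) x) (fam_pow_cont f hf k).1 _ _ (hNc δ) (hOo δ)
      (fun x hx => levO_mono (by linarith) (hn k (by omega) x hx))
  have e2 := fam_near (fun l x => (f l ^ m) x) (fam_pow_cont f hf m).1 _ _ (hNc δ)
    (hOo (δ - 1)) (fun x hx => hn m hmn x hx)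
  have e3 := fam_near (fun l x => (f l ^ m)⁻¹ x) (fam_pow_cont f hf m).2 _ _ (hNc η)
    (hOo (δ - 1)) (fun x hx => hηs hx)
  have e4 := fam_near (fun l x => (f l ^ (m * j)) x) (fam_pow_cont f hf (m * j)).1 _ _ (hNc δ)
    (hOo (η - 1)) (fun x hx => hj (m * j) (Nat.le_mul_of_pos_left j hm1) x hx)
  obtain ⟨lam₀, hl0, hall⟩ := ev_zero (e1.and (e2.and (e3.and e4)))
  have main : ∀ lam : unitInterval, 0 < (lam : ℝ) → (lam : ℝ) < lam₀ →
      ∃ K', IsCompact K' ∧ IsAttractor (f lam) K' ∧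
        (∀ i : ℕ, K' ⊆ (f lam ^ (m * i)) '' levN K β δ) ∧
        ∃ ε < δ, IsSpine 3 (β '' (univ ×ˢ Icc ε δ)) K' := by
    intro lam hp hl
    obtain ⟨a1, a2, a3, a4⟩ := hall lam hl
    exact fixed_lambda hM hc (f lam) (hhopf lam hp) (η - 1) η (δ - 1) δ (by linarith) hη
      (by linarith) m j hm1 (fun k h1 h2 => a1 k (Finset.mem_Ico.2 ⟨h1, h2⟩)) a2 a3 a4
  choose! Kf hKf using main
  refine ⟨lam₀, hl0, Kf, ?_, ?_⟩
  · intro lam hp hl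
    obtain ⟨c1, c2, -, ε, hε, c3⟩ := hKf lam hp hl
    exact ⟨c1, c2, _, (isCompact_univ.prod isCompact_Icc).image hb1.continuous,
      shell_homeo β hb1 ε δ hε, c3⟩
  · intro V hV
    obtain ⟨i, hi⟩ := hst' (interior V)
      (isOpen_interior.mem_nhdsSet.2 (subset_interior_iff_mem_nhdsSet.2 hV))
    have e5 := fam_near (fun l x => (f l ^ (m * i)) x) (fam_pow_cont f hf (m * i)).1 _ _ (hNc δ)
      isOpen_interior (fun x hx => hi (m * i) (Nat.le_mul_of_pos_left i hm1) x hx)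
    obtain ⟨r, hr, hr'⟩ := ev_zero e5
    refine ⟨min r lam₀, lt_min hr hl0, fun lam hp hl => ?_⟩
    intro y hy
    obtain ⟨x, hx, rfl⟩ := (hKf lam hp (hl.trans_le (min_le_right _ _))).2.2.1 i hy
    exact interior_subset (hr' lam (hl.trans_le (min_le_left _ _)) x hx)
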